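/- arXiv:1306.3260 — 2 statements merged into one kernel-verified Lean document; each statement's English description precedes it below -/
import Mathlib

section
/- Let Γ be a finite graph on vertex set V in which each vertex may carry a loop, given by a symmetric adjacency relation E on pairs of distinct vertices together with a set of looped vertices. Then every language in VA(M(Γ)) (over every finite alphabet) is semilinear if and only if both of the following hold: (1) Γ contains no induced subgraph consisting of two adjacent unlooped vertices, and no induced subgraph on three vertices u, v, w in which v is unlooped, u and w are looped, v is adjacent to both u and w, and u is not adjacent to w; (2) the underlying loop-free graph of Γ contains neither an induced cycle on 4 vertices (C₄) nor an induced path on 4 vertices (P₄). -/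
namespace Paper

/-- `VA M L`: the language `L ⊆ X*` is accepted by a valence automaton over the monoid `M`,
via the standard characterization: there are a finite alphabet `Y`, a regular language
`R ⊆ Y*`, and monoid homomorphisms `φ : Y* → M`, `h : Y* → X*` with `L = h(R ∩ φ⁻¹(1))`. -/
def VA (M : Type*) [Monoid M] {X : Type} (L : Language X) : Prop :=
  ∃ (Y : Type) (_ : Fintype Y) (R : Language Y)
    (φ : FreeMonoid Y →* M) (h : FreeMonoid Y →* FreeMonoid X),
    R.IsRegular ∧
      L = (fun w => FreeMonoid.toList (h w)) ''
            {w : FreeMonoid Y | FreeMonoid.toList w ∈ R ∧ φ w = 1}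

open Classical in
/-- The Parikh image of a word: the multiset counting occurrences of each letter. -/
noncomputable def parikh {X : Type} (w : List X) : X → ℕ := fun x => w.count x

/-- A linear subset of `X^⊕`. -/
def IsLinearSet {X : Type} (S : Set (X → ℕ)) : Prop :=
  ∃ (α₀ : X → ℕ) (n : ℕ) (α : Fin n → X → ℕ),
    S = {β | ∃ m : Fin n → ℕ, β = α₀ + ∑ i, m i • α i}

/-- A semilinear subset of `X^⊕`: a finite union of linear sets. -/
def IsSemilinearSet {X : Type} (S : Set (X → ℕ)) : Prop :=
  ∃ (n : ℕ) (T : Fin n → Set (X → ℕ)), (∀ i, IsLinearSet (T i)) ∧ S = ⋃ i, T i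

/-- A language is semilinear if its Parikh image is a semilinear set. -/
def LangSemilinear {X : Type} (L : Language X) : Prop := IsSemilinearSet (parikh '' L)

/-- Defining relation of the monoid `M(Γ)` for a graph `Γ` with vertex set `V`,
adjacency relation `E` (on distinct vertices) and looped vertices `Loop`: generators
are `a_v = (v, true)` and `ā_v = (v, false)`; we impose `a_v·ā_v = 1` for each `v`,
also `ā_v·a_v = 1` for each looped `v`, and generators at adjacent vertices commute. -/
def MGraphRel (V : Type) (E : V → V → Prop) (Loop : V → Prop) :
    FreeMonoid (V × Bool) → FreeMonoid (V × Bool) → Prop := fun x y =>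
  (∃ v : V, x = FreeMonoid.of (v, true) * FreeMonoid.of (v, false) ∧ y = 1) ∨
  (∃ v : V, Loop v ∧ x = FreeMonoid.of (v, false) * FreeMonoid.of (v, true) ∧ y = 1) ∨
  (∃ (v w : V) (s t : Bool), E v w ∧
      x = FreeMonoid.of (v, s) * FreeMonoid.of (w, t) ∧
      y = FreeMonoid.of (w, t) * FreeMonoid.of (v, s))

/-- The monoid `M(Γ)`: a copy of the bicyclic monoid for each unlooped vertex and a copy
of `ℤ` for each looped vertex, with copies at adjacent vertices commuting. -/
def MGraph (V : Type) (E : V → V → Prop) (Loop : V → Prop) : Type :=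
  (conGen (MGraphRel V E Loop)).Quotient

instance (V : Type) (E : V → V → Prop) (Loop : V → Prop) : Monoid (MGraph V E Loop) :=
  inferInstanceAs (Monoid (conGen (MGraphRel V E Loop)).Quotient)

section Substitution

variable {J M : Type} [AddCommMonoid M]

open Classical in
/-- `Subst X f m`: the vector `m` arises from `f` by replacing each occurrence of `j` in the
multiset `f` by some element of `X j` and adding up. -/
inductive Subst (X : J → Set M) : (J → ℕ) → M → Prop
  | zero : Subst X 0 0
  | cons {j : J} {x : M} {f : J → ℕ} {m : M} :
      x ∈ X j → Subst X f m → Subst X (Pi.single j 1 + f) (x + m)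

namespace Subst

variable {X X' : J → Set M} {f g : J → ℕ} {m n x : M} {j : J}

theorem add (h : Subst X f m) (h' : Subst X g n) : Subst X (f + g) (m + n) := by
  induction h with
  | zero => simpa using h'
  | cons hx _ ih => rw [add_assoc, add_assoc]; exact cons hx ih

theorem single {_ : DecidableEq J} (h : x ∈ X j) : Subst X (Pi.single j 1) x := by
  convert cons h zero using 1
  · rw [add_zero]
    congr!
  · rw [add_zero]

theorem mono_of_support (h : Subst X f m) (hX : ∀ j, f j ≠ 0 → X j ⊆ X' j) : Subst X' f m := by
  classical
  induction h with
  | zero => exact zero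
  | cons hx _ ih =>
    exact cons (hX _ (by simp) hx) (ih fun j hj => hX j (by simp; omega))

theorem mono (hX : ∀ j, X j ⊆ X' j) (h : Subst X f m) : Subst X' f m :=
  h.mono_of_support fun j _ => hX j

theorem split_aux {k : J → ℕ} (h : Subst X k m) :
    ∀ f g, k = f + g → ∃ a b, Subst X f a ∧ Subst X g b ∧ m = a + b := by
  classical
  induction h with
  | zero =>
    intro f g hk
    have hf : f = 0 := funext fun i => by have := congrFun hk i; simp at this; simp; omega
    have hg : g = 0 := funext fun i => by have := congrFun hk i; simp at this; simp; omega
    exact ⟨0, 0, hf ▸ zero, hg ▸ zero, by simp⟩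
  | @cons j x k m hx _ ih =>
    have key : ∀ f g : J → ℕ, Pi.single j 1 + k = f + g → 0 < f j →
        ∃ a b, Subst X f a ∧ Subst X g b ∧ x + m = a + b := by
      intro f g hk hf
      have hf' : f = Pi.single j 1 + (f - Pi.single j 1) := by
        funext i
        rcases eq_or_ne i j with rfl | hi
        · simp; omega
        · simp [hi]
      obtain ⟨a, b, ha, hb, rfl⟩ := ih (f - Pi.single j 1) g (by
        apply add_left_cancel (a := (Pi.single j 1 : J → ℕ))
        rw [hk, ← add_assoc, ← hf'])
      refine ⟨x + a, b, ?_, hb, by rw [add_assoc]⟩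
      rw [hf']
      exact cons hx ha
    intro f g hk
    have hj := congrFun hk j
    simp only [Pi.add_apply, Pi.single_eq_same] at hj
    rcases Nat.eq_zero_or_pos (f j) with h0 | h0
    · obtain ⟨a, b, ha, hb, h⟩ := key g f (by rw [hk, add_comm]) (by omega)
      exact ⟨b, a, hb, ha, by rw [h, add_comm]⟩
    · exact key f g hk h0

theorem split (h : Subst X (f + g) m) : ∃ a b, Subst X f a ∧ Subst X g b ∧ m = a + b :=
  split_aux h f g rfl

theorem eq_zero (h : Subst X 0 m) : m = 0 := by
  classical
  generalize hk : (0 : J → ℕ) = k at h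
  cases h with
  | zero => rfl
  | @cons j => exact absurd (congrFun hk j) (by simp; omega)

theorem mem_of_single {_ : DecidableEq J} (h : Subst X (Pi.single j 1) m) : m ∈ X j := by
  generalize hk : (Pi.single j 1 : J → ℕ) = k at h
  cases h with
  | zero => simpa using congrFun hk j
  | @cons i x f n hx h =>
    obtain rfl : i = j := by
      by_contra hij
      have := congrFun hk i
      simp [hij] at this
      omega
    obtain rfl : f = 0 := by
      ext l
      have := congrFun hk l
      simp only [Pi.single_apply, Pi.add_apply] at this
      simp only [Pi.zero_apply]
      split_ifs at this <;> omega
    simpa [h.eq_zero] using hx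

theorem comp {X : J → Set (J → ℕ)} {Y : J → Set M} :
    Subst (fun j => {m | ∃ g ∈ X j, Subst Y g m}) f m ↔ ∃ g, Subst X f g ∧ Subst Y g m := by
  constructor
  · intro h
    induction h with
    | zero => exact ⟨0, zero, zero⟩
    | cons hx _ ih =>
      obtain ⟨g, hg, hgx⟩ := hx
      obtain ⟨g', hg', hgx'⟩ := ih
      exact ⟨g + g', cons hg hg', hgx.add hgx'⟩
  · rintro ⟨g, hg, h⟩
    induction hg generalizing m with
    | zero => rw [h.eq_zero]; exact zero
    | cons hx _ ih =>
      obtain ⟨a, b, ha, hb, rfl⟩ := h.split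
      exact cons ⟨_, hx, ha⟩ (ih hb)

theorem sum_nsmul_mem [Fintype J] (y : J → M) (hy : ∀ j, y j ∈ X j) (f : J → ℕ) :
    Subst X f (∑ j, f j • y j) := by
  classical
  have h1 : ∀ (j : J) (k : ℕ), Subst X (Pi.single j k) (k • y j) := by
    intro j k
    induction k with
    | zero => simpa using zero
    | succ k ih => rw [Pi.single_add, add_nsmul, one_nsmul]; exact ih.add (single (hy j))
  have h2 : ∀ s : Finset J, Subst X (∑ j ∈ s, Pi.single j (f j)) (∑ j ∈ s, f j • y j) := by
    intro s
    induction s using Finset.induction_on with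
    | empty => simpa using zero
    | insert j s hj ih => rw [Finset.sum_insert hj, Finset.sum_insert hj]; exact (h1 _ _).add ih
  simpa [Finset.univ_sum_single] using h2 Finset.univ

open Classical in
theorem id_iff [Finite J] {f g : J → ℕ} :
    Subst (fun j => {(Pi.single j 1 : J → ℕ)}) f g ↔ g = f := by
  constructor
  · intro h
    induction h with
    | zero => rfl
    | cons hx _ ih => rw [Set.mem_singleton_iff.1 hx, ih]
  · rintro rfl
    cases nonempty_fintype J
    convert sum_nsmul_mem (X := fun j => {(Pi.single j 1 : J → ℕ)}) (fun j => Pi.single j 1)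
      (fun j => rfl) g
    ext i
    simp [Finset.sum_apply, Pi.single_apply]

open Classical in
theorem iff_mem_closure : Subst X f m ↔
    (f, m) ∈ AddSubmonoid.closure (⋃ j, (fun x => ((Pi.single j 1 : J → ℕ), x)) '' X j) := by
  constructor
  · intro h
    induction h with
    | zero => exact zero_mem _
    | cons hx _ ih =>
      rw [← Prod.mk_add_mk]
      exact add_mem (AddSubmonoid.subset_closure (Set.mem_iUnion.2 ⟨_, _, hx, rfl⟩)) ih
  · intro h
    suffices ∀ p ∈ AddSubmonoid.closure (⋃ j, (fun x => ((Pi.single j 1 : J → ℕ), x)) '' X j),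
        Subst X p.1 p.2 from this _ h
    intro p hp
    induction hp using AddSubmonoid.closure_induction with
    | mem p hp =>
      obtain ⟨j, x, hx, rfl⟩ := Set.mem_iUnion.1 hp
      exact single hx
    | zero => exact zero
    | add p q _ _ hp hq => exact hp.add hq

/-- Semilinear sets are closed under substitution. -/
theorem isSemilinearSet [Finite J] [AddMonoid.FG M] {S : Set (J → ℕ)}
    (hS : _root_.IsSemilinearSet S) (hX : ∀ j, _root_.IsSemilinearSet (X j)) :
    _root_.IsSemilinearSet {m | ∃ f ∈ S, Subst X f m} := by
  classical
  have h1 : _root_.IsSemilinearSet {p : (J → ℕ) × M | Subst X p.1 p.2} := by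
    have : {p : (J → ℕ) × M | Subst X p.1 p.2} =
        AddSubmonoid.closure (⋃ j, (fun x => ((Pi.single j 1 : J → ℕ), x)) '' X j) := by
      ext p
      exact iff_mem_closure
    rw [this]
    refine (IsSemilinearSet.iUnion fun j => ?_).closure
    have h := ((hX j).image (AddMonoidHom.inr (J → ℕ) M)).vadd ((Pi.single j 1 : J → ℕ), (0 : M))
    convert h using 1
    ext p
    simp [Set.mem_vadd_set]
  convert (h1.inter (hS.preimage (AddMonoidHom.fst (J → ℕ) M))).image
    (AddMonoidHom.snd (J → ℕ) M) using 1
  ext m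
  simp [and_comm]

end Subst

end Substitution

section Grammar

variable {J : Type}

open Classical in
/-- The family of sets replacing the symbol `B` by elements of `Z` and fixing all others. -/
noncomputable def replaceSymbol {M : Type} [Zero M] (e : J → M) (B : J) (Z : Set M) :
    J → Set M :=
  fun j => if j = B then Z else {e j}

open Classical Pointwise in
/-- One-variable case of Parikh's theorem: the least solution of `Z = S[B := Z]` is
`A + G*`, where `A` collects the elements of `S` without `B` and `G` arises from the other
elements by removing one `B` and replacing the remaining ones by elements of `A`. -/
theorem exists_least_oneVar [Finite J] (B : J) {S : Set (J → ℕ)}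
    (hS : _root_.IsSemilinearSet S) : ∃ Z : Set (J → ℕ), _root_.IsSemilinearSet Z ∧
      (∀ g ∈ S, ∀ z, Subst (replaceSymbol (fun j => Pi.single j 1) B Z) g z → z ∈ Z) ∧
      ∀ Q : Set (J → ℕ),
        (∀ g ∈ S, ∀ z, Subst (replaceSymbol (fun j => Pi.single j 1) B Q) g z → z ∈ Q) →
        Z ⊆ Q := by
  set e : J → J → ℕ := fun j => Pi.single j 1 with he
  have fixed : ∀ {Z : Set (J → ℕ)} {g z : J → ℕ}, g B = 0 →
      (Subst (replaceSymbol e B Z) g z ↔ z = g) := by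
    intro Z g z hg
    rw [← Subst.id_iff]
    constructor
    · refine fun h => h.mono_of_support fun j hj => ?_
      have : j ≠ B := by rintro rfl; exact hj hg
      simp [replaceSymbol, this, he]
    · refine fun h => h.mono_of_support fun j hj => ?_
      have : j ≠ B := by rintro rfl; exact hj hg
      simp [replaceSymbol, this, he]
  set A : Set (J → ℕ) := S ∩ (Pi.evalAddMonoidHom (fun _ : J => ℕ) B) ⁻¹' {0} with hA
  have hAs : _root_.IsSemilinearSet A := hS.inter ((IsSemilinearSet.singleton 0).preimage _)
  set H : Set (J → ℕ) := {h | h + e B ∈ S} with hH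
  have hHs : _root_.IsSemilinearSet H := by
    convert ((hS.preimage (AddMonoidHom.fst (J → ℕ) (J → ℕ) + AddMonoidHom.snd _ _)).inter
      ((IsSemilinearSet.singleton (e B)).preimage (AddMonoidHom.snd (J → ℕ) (J → ℕ)))).image
      (AddMonoidHom.fst _ _) using 1
    ext h
    simp [hH]
  set G : Set (J → ℕ) := {m | ∃ h ∈ H, Subst (replaceSymbol e B A) h m} with hG
  have hGs : _root_.IsSemilinearSet G := by
    refine Subst.isSemilinearSet hHs fun j => ?_
    by_cases hj : j = B <;> simp [replaceSymbol, hj, hAs]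
  refine ⟨A + (AddSubmonoid.closure G : Set (J → ℕ)), hAs.add hGs.closure, ?_, ?_⟩
  · intro g hg z hz
    by_cases h0 : g B = 0
    · rw [fixed h0] at hz
      subst hz
      exact ⟨z, ⟨hg, h0⟩, 0, zero_mem _, add_zero _⟩
    · obtain ⟨h, rfl⟩ : ∃ h, g = h + e B := ⟨g - e B, by
        funext i
        rcases eq_or_ne i B with rfl | hi
        · simp [he]; omega
        · simp [he, hi]⟩
      obtain ⟨a, b, ha, hb, rfl⟩ := hz.split
      have hb' := hb.mem_of_single
      simp only [replaceSymbol, if_true] at hb'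
      obtain ⟨b1, hb1, b2, hb2, rfl⟩ := hb'
      have key : ∀ {h a : J → ℕ},
          Subst (replaceSymbol e B (A + (AddSubmonoid.closure G : Set (J → ℕ)))) h a →
          ∃ a' c, Subst (replaceSymbol e B A) h a' ∧ c ∈ AddSubmonoid.closure G ∧
            a = a' + c := by
        intro h a ha
        induction ha with
        | zero => exact ⟨0, 0, .zero, zero_mem _, by simp⟩
        | @cons j x f m hx _ ih =>
          obtain ⟨a', c, h1, h2, rfl⟩ := ih
          by_cases hj : j = B
          · simp only [replaceSymbol, hj, if_true] at hx
            obtain ⟨x1, hx1, x2, hx2, rfl⟩ := hx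
            refine ⟨x1 + a', x2 + c, .cons (by simpa [replaceSymbol, hj] using hx1) h1,
              add_mem hx2 h2, ?_⟩
            simp only
            abel
          · refine ⟨x + a', c, .cons (by simpa [replaceSymbol, hj] using hx) h1, h2, ?_⟩
            abel
      obtain ⟨a', c, ha', hc, rfl⟩ := key ha
      refine ⟨b1, hb1, a' + c + b2, add_mem (add_mem (AddSubmonoid.subset_closure ?_) hc) hb2, ?_⟩
      · exact ⟨h, hg, ha'⟩
      · simp only
        abel
  · rintro Q hQ _ ⟨a, ha, c, hc, rfl⟩
    have hAQ : A ⊆ Q := fun a ha => hQ a ha.1 a ((fixed ha.2).2 rfl)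
    have : ∀ z ∈ Q, z + c ∈ Q := by
      induction hc using AddSubmonoid.closure_induction with
      | mem c hc =>
        obtain ⟨h, hh, hs⟩ := hc
        intro z hz
        refine hQ _ hh _ ?_
        rw [add_comm z c]
        refine Subst.add (hs.mono fun j => ?_) (Subst.single ?_)
        · by_cases hj : j = B <;> simp [replaceSymbol, hj, hAQ]
        · simpa [replaceSymbol] using hz
      | zero => simp
      | add c d _ _ hc hd =>
        intro z hz
        rw [← add_assoc]
        exact hd _ (hc _ hz)
    exact this a (hAQ ha)

open Classical in
/-- Elimination of a finite set `U` of nonterminals from a commutative grammar with semilinear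
sets of right-hand sides. -/
theorem exists_least_family [Finite J] {S : J → Set (J → ℕ)}
    (hS : ∀ j, _root_.IsSemilinearSet (S j)) (U : Finset J) : ∃ X : J → Set (J → ℕ),
      (∀ j, _root_.IsSemilinearSet (X j)) ∧ (∀ j ∉ U, X j = {Pi.single j 1}) ∧
      (∀ j ∈ U, ∀ f ∈ S j, ∀ g, Subst X f g → g ∈ X j) ∧
      ∀ (M : Type) [AddCommMonoid M] (Y : J → Set M),
        (∀ j ∈ U, ∀ f ∈ S j, ∀ m, Subst Y f m → m ∈ Y j) →
        ∀ j, ∀ g ∈ X j, ∀ m, Subst Y g m → m ∈ Y j := by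
  induction U using Finset.induction_on with
  | empty =>
    refine ⟨fun j => {Pi.single j 1}, fun j => .singleton _, fun _ _ => rfl, by simp, ?_⟩
    rintro M _ Y - j g rfl m hm
    exact hm.mem_of_single
  | insert B U hB ih =>
    obtain ⟨X, hXs, hXt, hXc, hXl⟩ := ih
    obtain ⟨Z, hZs, hZc, hZl⟩ := exists_least_oneVar B (Subst.isSemilinearSet (hS B) hXs)
    set τ := replaceSymbol (fun j => (Pi.single j 1 : J → ℕ)) B Z with hτ
    have hτs : ∀ j, _root_.IsSemilinearSet (τ j) := fun j => by
      by_cases hj : j = B <;> simp [hτ, replaceSymbol, hj, hZs]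
    have term : ∀ {j : J}, j ∉ U → {m | ∃ g ∈ X j, Subst τ g m} = τ j := by
      intro j hj
      ext m
      simp only [hXt j hj, Set.mem_singleton_iff, exists_eq_left, Set.mem_ofPred_eq]
      exact ⟨Subst.mem_of_single, Subst.single⟩
    refine ⟨fun j => {m | ∃ g ∈ X j, Subst τ g m},
      fun j => Subst.isSemilinearSet (hXs j) hτs, ?_, ?_, ?_⟩
    · intro j hj
      simp only [Finset.mem_insert, not_or] at hj
      simp only [term hj.2]
      simp [hτ, replaceSymbol, hj.1]
    · intro j hj f hf g hg
      obtain ⟨h, hfh, hhg⟩ := Subst.comp.1 hg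
      rcases Finset.mem_insert.1 hj with rfl | hjU
      · have := hZc h ⟨f, hf, hfh⟩ g hhg
        show g ∈ {m | ∃ g ∈ X _, Subst τ g m}
        rw [term hB]
        simpa [hτ, replaceSymbol] using this
      · exact ⟨h, hXc j hjU f hf h hfh, hhg⟩
    · intro M _ Y hY
      have hXY := hXl M Y fun j hj => hY j (Finset.mem_insert_of_mem hj)
      have hZY : Z ⊆ {z | ∀ m, Subst Y z m → m ∈ Y B} := by
        refine hZl _ ?_
        rintro g ⟨f, hf, hfg⟩ z hgz m hzm
        have h1 : Subst Y g m := by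
          refine (Subst.comp.2 ⟨z, hgz, hzm⟩).mono fun j => ?_
          rintro n ⟨x, hx, hxn⟩
          by_cases hj : j = B
          · subst hj
            simp only [replaceSymbol, if_true] at hx
            exact hx n hxn
          · simp only [replaceSymbol, hj, if_false, Set.mem_singleton_iff] at hx
            subst hx
            exact hxn.mem_of_single
        refine hY B (Finset.mem_insert_self _ _) f hf m ?_
        refine (Subst.comp.2 ⟨g, hfg, h1⟩).mono fun j => ?_
        rintro n ⟨x, hx, hxn⟩
        exact hXY j x hx n hxn
      rintro j g ⟨h, hh, hhg⟩ m hgm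
      refine hXY j h hh m ?_
      refine (Subst.comp.2 ⟨g, hhg, hgm⟩).mono fun i => ?_
      rintro n ⟨x, hx, hxn⟩
      by_cases hi : i = B
      · subst hi
        simp only [hτ, replaceSymbol, if_true] at hx
        exact hZY hx n hxn
      · simp only [hτ, replaceSymbol, hi, if_false, Set.mem_singleton_iff] at hx
        subst hx
        exact hxn.mem_of_single

variable {N T : Type}

open Classical in
/-- Substitution of nonterminals in `N` by the sets `Y`, fixing the terminals in `T`. -/
noncomputable def terminalFamily (Y : N → Set (T → ℕ)) : N ⊕ T → Set (T → ℕ) :=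
  Sum.elim Y fun t => {Pi.single t 1}

/-- Parikh's theorem for commutative grammars with semilinear sets of right-hand sides. -/
theorem isSemilinearSet_of_isLeast [Finite N] [Finite T] {S : N → Set (N ⊕ T → ℕ)}
    (hS : ∀ n, _root_.IsSemilinearSet (S n)) (Y : N → Set (T → ℕ))
    (hY : ∀ n, ∀ f ∈ S n, ∀ m, Subst (terminalFamily Y) f m → m ∈ Y n)
    (hleast : ∀ X : N → Set (T → ℕ),
      (∀ n, ∀ f ∈ S n, ∀ m, Subst (terminalFamily X) f m → m ∈ X n) → ∀ n, Y n ⊆ X n)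
    (n : N) : _root_.IsSemilinearSet (Y n) := by
  classical
  cases nonempty_fintype N
  obtain ⟨X, hXs, hXt, hXc, hXl⟩ := exists_least_family (S := Sum.elim S fun _ => ∅)
    (by rintro (n | t) <;> simp [hS]) (Finset.univ.map Function.Embedding.inl)
  set X' : N → Set (T → ℕ) :=
    fun n => {v | ∃ g ∈ X (.inl n), Subst (terminalFamily fun _ => ∅) g v} with hX'
  have hfam : ∀ j, terminalFamily X' j =
      {v | ∃ g ∈ X j, Subst (terminalFamily fun _ : N => (∅ : Set (T → ℕ))) g v} := by
    rintro (n | t)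
    · rfl
    · ext v
      rw [hXt _ (by simp)]
      simp only [Set.mem_singleton_iff, exists_eq_left, Set.mem_ofPred_eq]
      exact ⟨fun h => Subst.single h, fun h => h.mem_of_single⟩
  have hYX : Y n = X' n := by
    apply subset_antisymm
    · refine hleast X' (fun n f hf m hm => ?_) n
      rw [funext hfam] at hm
      obtain ⟨g, hfg, hgm⟩ := Subst.comp.1 hm
      exact ⟨g, hXc (.inl n) (by simp) f hf g hfg, hgm⟩
    · rintro v ⟨g, hg, hgv⟩
      refine hXl _ (terminalFamily Y) ?_ (.inl n) g hg v (hgv.mono ?_)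
      · rintro (n | t) hj f hf m hm
        · exact hY n f hf m hm
        · simp at hf
      · rintro (n | t) <;> simp [terminalFamily]
  rw [hYX]
  refine Subst.isSemilinearSet (hXs _) ?_
  rintro (n | t) <;> simp [terminalFamily]

end Grammar

section Path

variable {Q G T : Type}

/-- `Path Δ p w v q`: some path from `p` to `q` in the automaton with transition relation `Δ`
reads the word `w` and has total weight `v`. -/
inductive Path {M : Type} [AddCommMonoid M] (Δ : Q → Option G → M → Q → Prop) :
    Q → List G → M → Q → Prop
  | nil (p : Q) : Path Δ p [] 0 p
  | cons {p q r : Q} {o : Option G} {w : List G} {v v' : M} :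
      Δ p o v q → Path Δ q w v' r → Path Δ p (o.toList ++ w) (v + v') r

namespace Path

variable {M : Type} [AddCommMonoid M] {Δ Δ' : Q → Option G → M → Q → Prop} {p q r : Q}
  {v v' : M} {w x y : List G} {g : G}

theorem append (h : Path Δ p x v q) (h' : Path Δ q y v' r) : Path Δ p (x ++ y) (v + v') r := by
  induction h with
  | nil => simpa using h'
  | cons hd _ ih => rw [List.append_assoc, add_assoc]; exact cons hd (ih h')

theorem epsilon (h : Δ p none v q) : Path Δ p [] v q := by
  simpa using cons h (nil q)

theorem letter (h : Δ p (some g) v q) : Path Δ p [g] v q := by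
  simpa using cons h (nil q)

theorem mono (h : Path Δ p w v q)
    (hΔ : ∀ p o v q, (∀ g ∈ o, g ∈ w) → Δ p o v q → Δ' p o v q) : Path Δ' p w v q := by
  induction h with
  | nil => exact nil _
  | cons hd _ ih =>
    refine cons (hΔ _ _ _ _ (fun g hg => by simp [Option.mem_def.1 hg]) hd) (ih ?_)
    exact fun p o v q ho => hΔ p o v q fun g hg => List.mem_append_right _ (ho g hg)

theorem split (h : Path Δ p w v r) : ∀ x y, w = x ++ y →
    ∃ q v₁ v₂, Path Δ p x v₁ q ∧ Path Δ q y v₂ r ∧ v = v₁ + v₂ := by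
  induction h with
  | nil p =>
    intro x y hw
    obtain ⟨rfl, rfl⟩ := List.append_eq_nil_iff.1 hw.symm
    exact ⟨p, 0, 0, nil p, nil p, by simp⟩
  | @cons p q r o w v v' hd hp ih =>
    intro x y hw
    cases o with
    | none =>
      obtain ⟨s, v₁, v₂, h₁, h₂, rfl⟩ := ih x y hw
      exact ⟨s, v + v₁, v₂, cons hd h₁, h₂, by rw [add_assoc]⟩
    | some g =>
      cases x with
      | nil => exact ⟨p, 0, v + v', nil p, by subst hw; exact cons hd hp, by simp⟩
      | cons g' x =>
        simp only [Option.toList_some, List.cons_append, List.nil_append,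
          List.cons.injEq] at hw
        obtain ⟨rfl, rfl⟩ := hw
        obtain ⟨s, v₁, v₂, h₁, h₂, rfl⟩ := ih x y rfl
        exact ⟨s, v + v₁, v₂, cons hd h₁, h₂, by rw [add_assoc]⟩

theorem split_cons (h : Path Δ p (g :: w) v q) :
    ∃ r s v₁ v₂ v₃, Path Δ p [] v₁ r ∧ Δ r (some g) v₂ s ∧ Path Δ s w v₃ q ∧
      v = v₁ + (v₂ + v₃) := by
  generalize hx : g :: w = x at h
  induction h with
  | nil p => simp at hx
  | @cons p q r o x v v' hd hp ih =>
    cases o with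
    | none =>
      obtain ⟨s, t, v₁, v₂, v₃, h₁, h₂, h₃, rfl⟩ := ih hx
      exact ⟨s, t, v + v₁, v₂, v₃, (epsilon hd).append h₁, h₂, h₃, by rw [add_assoc]⟩
    | some g' =>
      simp only [Option.toList_some, List.cons_append, List.nil_append, List.cons.injEq] at hx
      obtain ⟨rfl, rfl⟩ := hx
      exact ⟨p, q, 0, v, v', nil p, hd, hp, by simp⟩

theorem letters_mem {U : Set G} (hU : ∀ p g v q, Δ p (some g) v q → g ∈ U)
    (h : Path Δ p w v q) : ∀ g ∈ w, g ∈ U := by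
  induction h with
  | nil => simp
  | @cons _ _ _ o _ _ _ hd _ ih =>
    cases o with
    | none => exact ih
    | some g => simpa using ⟨hU _ _ _ _ hd, ih⟩

end Path

/-- The transition relation `Δ` with additional spontaneous transitions from `p` to `q` of every
weight in `X (p, q)`. -/
def withJumps (Δ : Q → Option G → (T → ℕ) → Q → Prop) (X : Q × Q → Set (T → ℕ)) :
    Q → Option G → (T → ℕ) → Q → Prop :=
  fun p o v q => Δ p o v q ∨ o = none ∧ v ∈ X (p, q)

/-- The words that arise from the empty word by successively inserting words in `W`. -/
inductive Insertion (W : Set (List G)) : List G → Prop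
  | nil : Insertion W []
  | insert {x y z : List G} : Insertion W (x ++ y) → z ∈ W → Insertion W (x ++ z ++ y)

theorem Insertion.mem_of_path {W : Set (List G)} {Δ : Q → Option G → (T → ℕ) → Q → Prop}
    {X : Q × Q → Set (T → ℕ)}
    (hX : ∀ p q z v, (z = [] ∨ z ∈ W) → Path (withJumps Δ X) p z v q → v ∈ X (p, q))
    {w : List G} (hw : Insertion W w) {p q : Q} {v : T → ℕ}
    (h : Path (withJumps Δ X) p w v q) : v ∈ X (p, q) := by
  induction hw generalizing p q v with
  | nil => exact hX _ _ _ _ (.inl rfl) h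
  | insert _ hz ih =>
    obtain ⟨s, v₁, v₂, h₁, h₂, rfl⟩ := h.split _ _ rfl
    obtain ⟨r, v₃, v₄, h₃, h₄, rfl⟩ := h₁.split _ _ rfl
    have := hX _ _ _ _ (.inr hz) h₄
    refine ih ?_
    rw [add_assoc]
    exact h₃.append (Path.cons (o := none) (.inr ⟨rfl, this⟩) h₂)

/-- The inclusion of terminal vectors into vectors over nonterminals and terminals. -/
def terminalHom (N T : Type) : (T → ℕ) →+ (N ⊕ T → ℕ) where
  toFun v := Sum.elim 0 v
  map_zero' := by ext (i | i) <;> rfl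
  map_add' v v' := by ext (i | i) <;> simp

open Classical in
theorem subst_terminalHom_iff {N : Type} [Finite T] {X : N → Set (T → ℕ)} {v m : T → ℕ} :
    Subst (terminalFamily X) (terminalHom N T v) m ↔ m = v := by
  have h1 : ∀ v : T → ℕ, Subst (terminalFamily X) (terminalHom N T v) v := by
    intro v
    induction v using Pi.single_induction with
    | zero => rw [map_zero]; exact .zero
    | add f g hf hg => rw [map_add]; exact hf.add hg
    | single i k =>
      induction k with
      | zero => rw [Pi.single_zero, map_zero]; exact .zero
      | succ k ih =>
        rw [Pi.single_add, map_add]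
        refine ih.add ?_
        have : terminalHom N T (Pi.single i 1) = Pi.single (Sum.inr i) 1 := by
          ext (j | j) <;> simp [terminalHom, Pi.single_apply]
        rw [this]
        exact Subst.single (X := terminalFamily X) (j := .inr i) (Set.mem_singleton _)
  constructor
  · intro h
    generalize hk : terminalHom N T v = k at h
    induction h generalizing v with
    | zero =>
      ext i
      simpa [terminalHom] using (congrFun hk (.inr i)).symm
    | @cons j x f m hx _ ih =>
      rcases j with n | i
      · have := congrFun hk (.inl n)
        simp [terminalHom] at this
        omega
      · obtain ⟨u, rfl⟩ : ∃ u, v = Pi.single i 1 + u := ⟨v - Pi.single i 1, by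
          ext j
          have := congrFun hk (.inr j)
          rcases eq_or_ne j i with rfl | hj
          · simp [terminalHom] at this ⊢
            omega
          · simp [hj]⟩
        have hx' : x = Pi.single i 1 := hx
        rw [hx', ih (v := u)]
        ext (j | j)
        · simpa [terminalHom] using congrFun hk (.inl j)
        · simpa [terminalHom, Pi.single_apply] using congrFun hk (.inr j)
  · rintro rfl
    exact h1 _

open Classical in
/-- The automaton with transitions `Δ` and symbolic jumps from `p` to `q` weighted by the
nonterminal `(p, q)`. -/
def symbolic (Δ : Q → Option G → (T → ℕ) → Q → Prop) :
    Q → Option G → ((Q × Q) ⊕ T → ℕ) → Q → Prop :=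
  fun p o f q => (∃ v, Δ p o v q ∧ f = terminalHom _ _ v) ∨
    o = none ∧ f = Pi.single (.inl (p, q)) 1

theorem exists_symbolic_of_withJumps [Finite T] {Δ : Q → Option G → (T → ℕ) → Q → Prop}
    {X : Q × Q → Set (T → ℕ)} {p q : Q} {o : Option G} {v : T → ℕ}
    (h : withJumps Δ X p o v q) :
    ∃ f, symbolic Δ p o f q ∧ Subst (terminalFamily X) f v := by
  rcases h with h | ⟨rfl, hv⟩
  · exact ⟨_, .inl ⟨_, h, rfl⟩, subst_terminalHom_iff.2 rfl⟩
  · exact ⟨_, .inr ⟨rfl, rfl⟩, Subst.single (X := terminalFamily X) (j := .inl (_, _)) hv⟩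

theorem Path.exists_symbolic [Finite T] {Δ : Q → Option G → (T → ℕ) → Q → Prop}
    {X : Q × Q → Set (T → ℕ)} {p q : Q} {w : List G} {v : T → ℕ}
    (h : Path (withJumps Δ X) p w v q) :
    ∃ f, Path (symbolic Δ) p w f q ∧ Subst (terminalFamily X) f v := by
  induction h with
  | nil p => exact ⟨0, nil p, .zero⟩
  | cons hd _ ih =>
    obtain ⟨f, hf, hfv⟩ := ih
    obtain ⟨f', hf', hfv'⟩ := exists_symbolic_of_withJumps hd
    exact ⟨_, cons hf' hf, hfv'.add hfv⟩

theorem Path.of_symbolic [Finite T] {K : Type} [Monoid K] (φ : List G → K)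
    (hnil : φ [] = 1) (happ : ∀ x y, φ (x ++ y) = φ x * φ y)
    {Δ : Q → Option G → (T → ℕ) → Q → Prop} {p q : Q} {z : List G}
    {f : (Q × Q) ⊕ T → ℕ} (h : Path (symbolic Δ) p z f q) {m : T → ℕ}
    (hm : Subst (terminalFamily fun n => {v | ∃ w, Path Δ n.1 w v n.2 ∧ φ w = 1}) f m) :
    ∃ w, Path Δ p w m q ∧ φ w = φ z := by
  induction h generalizing m with
  | nil p => rw [hm.eq_zero]; exact ⟨[], nil p, rfl⟩
  | cons hd _ ih =>
    obtain ⟨a, b, ha, hb, rfl⟩ := hm.split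
    obtain ⟨w, hw, hwz⟩ := ih hb
    rcases hd with ⟨v, hv, rfl⟩ | ⟨rfl, rfl⟩
    · rw [subst_terminalHom_iff.1 ha]
      exact ⟨_, cons hv hw, by rw [happ, happ, hwz]⟩
    · obtain ⟨w', hw', h1⟩ := ha.mem_of_single
      exact ⟨w' ++ w, hw'.append hw, by rw [happ, happ, h1, hwz, Option.toList_none, hnil]⟩

theorem isSemilinearSet_symbolic [Finite Q] [Finite T]
    {Δ : Q → Option G → (T → ℕ) → Q → Prop}
    (hΔ : ∀ p o q, _root_.IsSemilinearSet {v | Δ p o v q}) (p : Q) (o : Option G) (q : Q) :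
    _root_.IsSemilinearSet {f | symbolic Δ p o f q} := by
  classical
  refine ((hΔ p o q).image (terminalHom (Q × Q) T)).union
    (s₂ := {f | o = none ∧ f = Pi.single (.inl (p, q)) 1}) ?_ |> Eq.subst ?_
  · ext f
    simp [symbolic, eq_comm]
  · by_cases ho : o = none
    · simp [ho]
    · simp [ho]

/-- If the words accepted by an automaton arise by insertion of words in `W` and the weights of
paths reading words in `W` are generated by a commutative grammar, then the weights of accepted
words form a semilinear set. -/
theorem isSemilinearSet_of_insertion [Finite Q] [Finite T] {K : Type} [Monoid K]
    (φ : List G → K) (hnil : φ [] = 1) (happ : ∀ x y, φ (x ++ y) = φ x * φ y)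
    {Δ : Q → Option G → (T → ℕ) → Q → Prop} {W : Set (List G)}
    (hW : ∀ p w v q, Path Δ p w v q → φ w = 1 → Insertion W w)
    {S : Q × Q → Set ((Q × Q) ⊕ T → ℕ)} (hS : ∀ n, _root_.IsSemilinearSet (S n))
    (hSφ : ∀ p q, ∀ f ∈ S (p, q), ∃ z, Path (symbolic Δ) p z f q ∧ φ z = 1)
    (hX : ∀ X : Q × Q → Set (T → ℕ),
      (∀ n, ∀ f ∈ S n, ∀ m, Subst (terminalFamily X) f m → m ∈ X n) →
      ∀ p q z v, (z = [] ∨ z ∈ W) → Path (withJumps Δ X) p z v q → v ∈ X (p, q))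
    (p q : Q) : _root_.IsSemilinearSet {v | ∃ w, Path Δ p w v q ∧ φ w = 1} := by
  refine isSemilinearSet_of_isLeast hS (fun n => {v | ∃ w, Path Δ n.1 w v n.2 ∧ φ w = 1}) ?_ ?_
    (p, q)
  · rintro ⟨p, q⟩ f hf m hm
    obtain ⟨z, hz, h1⟩ := hSφ p q f hf
    obtain ⟨w, hw, hwz⟩ := hz.of_symbolic φ hnil happ hm
    exact ⟨w, hw, hwz.trans h1⟩
  · rintro X hXc ⟨p, q⟩ v ⟨w, hw, hwD⟩
    exact (hW _ _ _ _ hw hwD).mem_of_path (hX X hXc) (hw.mono fun _ _ _ _ _ => .inl)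

end Path

section GraphMonoid

variable {V : Type} (E : V → V → Prop) (Loop : V → Prop)

/-- The element of `M(Γ)` represented by a word in the generators. -/
def wordVal (w : List (V × Bool)) : MGraph V E Loop :=
  (conGen (MGraphRel V E Loop)).mk' (FreeMonoid.ofList w)

variable {E Loop}

theorem wordVal_nil : wordVal E Loop [] = 1 := rfl

theorem wordVal_append (x y : List (V × Bool)) :
    wordVal E Loop (x ++ y) = wordVal E Loop x * wordVal E Loop y := rfl

theorem wordVal_cons (g : V × Bool) (w : List (V × Bool)) :
    wordVal E Loop (g :: w) = wordVal E Loop [g] * wordVal E Loop w := rfl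

theorem wordVal_surjective : Function.Surjective (wordVal E Loop) := fun m =>
  let ⟨x, hx⟩ := (conGen (MGraphRel V E Loop)).mk'_surjective m
  ⟨FreeMonoid.toList x, hx⟩

theorem wordVal_eq_of_rel {x y : List (V × Bool)}
    (h : MGraphRel V E Loop (FreeMonoid.ofList x) (FreeMonoid.ofList y)) :
    wordVal E Loop x = wordVal E Loop y :=
  (Con.eq _).2 (ConGen.Rel.of _ _ h)

theorem wordVal_mul_bar (v : V) :
    wordVal E Loop [(v, true)] * wordVal E Loop [(v, false)] = 1 :=
  wordVal_eq_of_rel (x := [(v, true), (v, false)]) (y := []) (.inl ⟨v, rfl, rfl⟩)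

theorem wordVal_bar_mul {v : V} (hv : Loop v) :
    wordVal E Loop [(v, false)] * wordVal E Loop [(v, true)] = 1 :=
  wordVal_eq_of_rel (x := [(v, false), (v, true)]) (y := []) (.inr (.inl ⟨v, hv, rfl, rfl⟩))

theorem wordVal_commute {v w : V} (h : E v w) (s t : Bool) :
    Commute (wordVal E Loop [(v, s)]) (wordVal E Loop [(w, t)]) :=
  wordVal_eq_of_rel (x := [(v, s), (w, t)]) (y := [(w, t), (v, s)])
    (.inr (.inr ⟨v, w, s, t, h, rfl, rfl⟩))

/-- The homomorphism from `M(Γ)` given by images of the generators satisfying the relations. -/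
def liftHom {K : Type} [Monoid K] (f : V × Bool → K)
    (hf : ∀ v, f (v, true) * f (v, false) = 1)
    (hloop : ∀ v, Loop v → f (v, false) * f (v, true) = 1)
    (hcomm : ∀ v w s t, E v w → f (v, s) * f (w, t) = f (w, t) * f (v, s)) :
    MGraph V E Loop →* K :=
  Con.lift _ (FreeMonoid.lift f) (by
    refine Con.conGen_le.2 ?_
    rintro x y (⟨v, rfl, rfl⟩ | ⟨v, hv, rfl, rfl⟩ | ⟨v, w, s, t, h, rfl, rfl⟩)
    · simpa [Con.ker_rel] using hf v
    · simpa [Con.ker_rel] using hloop v hv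
    · simpa [Con.ker_rel] using hcomm v w s t h)

theorem liftHom_wordVal {K : Type} [Monoid K] (f : V × Bool → K) (hf hloop hcomm)
    (w : List (V × Bool)) :
    liftHom (E := E) (Loop := Loop) f hf hloop hcomm (wordVal E Loop w) = (w.map f).prod :=
  (Con.lift_mk' _ _).trans (FreeMonoid.lift_apply f _)

theorem foldl_eq_of_wordVal_eq {S : Type} (act : S → V × Bool → S)
    (hbar : ∀ v s, act (act s (v, true)) (v, false) = s)
    (hloop : ∀ v, Loop v → ∀ s, act (act s (v, false)) (v, true) = s)
    (hcomm : ∀ v w b c, E v w → ∀ s, act (act s (v, b)) (w, c) = act (act s (w, c)) (v, b))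
    {x y : List (V × Bool)} (h : wordVal E Loop x = wordVal E Loop y) (s : S) :
    x.foldl act s = y.foldl act s := by
  have key : ∀ w : List (V × Bool), ∀ s,
      ((w.map fun g => MulOpposite.op (show Function.End S from fun s => act s g)).prod).unop s =
        w.foldl act s := by
    intro w
    induction w with
    | nil => intro s; rfl
    | cons g w ih => intro s; rw [List.map_cons, List.prod_cons]; exact ih (act s g)
  rw [← key, ← key, ← liftHom_wordVal (E := E) (Loop := Loop), h, liftHom_wordVal]
  · exact fun v => congrArg MulOpposite.op (funext (hbar v))
  · exact fun v hv => congrArg MulOpposite.op (funext (hloop v hv))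
  · exact fun v w b c h => congrArg MulOpposite.op (funext (hcomm v w b c h))

open Classical in
/-- The action of the generators on a counter for the vertex `v`, where `none` is the state
reached by decrementing zero. -/
noncomputable def counterAct (v : V) (o : Option ℕ) (g : V × Bool) : Option ℕ :=
  if g.1 = v then o.bind fun n => if g.2 then some (n + 1) else if n = 0 then none else some (n - 1)
  else o

theorem counterAct_self_true (v : V) (n : ℕ) : counterAct v (some n) (v, true) = some (n + 1) := by
  simp [counterAct]

theorem counterAct_self_false_succ (v : V) (n : ℕ) :
    counterAct v (some (n + 1)) (v, false) = some n := by
  simp [counterAct]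

theorem counterAct_self_false_zero (v : V) : counterAct v (some 0) (v, false) = none := by
  simp [counterAct]

theorem counterAct_none (v : V) (g : V × Bool) : counterAct v none g = none := by
  simp [counterAct]

theorem counterAct_bar (v u : V) (o : Option ℕ) :
    counterAct v (counterAct v o (u, true)) (u, false) = o := by
  by_cases h : u = v
  · subst h
    cases o <;> simp [counterAct]
  · simp [counterAct, h]

theorem counterAct_bar_loop {v : V} (hv : ¬ Loop v) (u : V) (hu : Loop u) (o : Option ℕ) :
    counterAct v (counterAct v o (u, false)) (u, true) = o := by
  have h : u ≠ v := by rintro rfl; exact hv hu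
  simp [counterAct, h]

theorem counterAct_comm (hirr : ∀ v, ¬ E v v) (v u w : V) (b c : Bool) (h : E u w)
    (o : Option ℕ) :
    counterAct v (counterAct v o (u, b)) (w, c) = counterAct v (counterAct v o (w, c)) (u, b) := by
  by_cases hu : u = v
  · have hw : w ≠ v := by rintro rfl; exact hirr _ (hu ▸ h)
    simp [counterAct, hw]
  · simp [counterAct, hu]

theorem counterAct_foldl (hirr : ∀ v, ¬ E v v) {v : V} (hv : ¬ Loop v) {x y : List (V × Bool)}
    (h : wordVal E Loop x = wordVal E Loop y) (o : Option ℕ) :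
    x.foldl (counterAct v) o = y.foldl (counterAct v) o :=
  foldl_eq_of_wordVal_eq _ (counterAct_bar v) (counterAct_bar_loop hv) (counterAct_comm hirr v) h o

variable (E Loop)

/-- Every finite automaton with labels over the vertices in `U` and semilinear sets of weights
accepts a semilinear set of weights, where a path accepts if its word represents `1`. -/
def PathSemilinear (U : Set V) : Prop :=
  ∀ (Q T : Type) [Finite Q] [Finite T] (Δ : Q → Option (V × Bool) → (T → ℕ) → Q → Prop),
    (∀ p o q, _root_.IsSemilinearSet {v | Δ p o v q}) →
    (∀ p g v q, Δ p (some g) v q → g.1 ∈ U) →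
    ∀ p q, _root_.IsSemilinearSet {v | ∃ w, Path Δ p w v q ∧ wordVal E Loop w = 1}

variable {E Loop}

theorem insertion_of_counterAct {v : V} {w : List (V × Bool)} (hw : ∀ g ∈ w, g.1 = v) :
    ∀ n : ℕ, w.foldl (counterAct v) (some n) = some 0 →
      Insertion {[(v, true), (v, false)]} (List.replicate n (v, true) ++ w) := by
  induction w with
  | nil =>
    intro n h
    obtain rfl : n = 0 := by simpa using h
    exact .nil
  | cons g w ih =>
    obtain ⟨u, b⟩ := g
    obtain rfl : u = v := hw (u, b) (by simp)
    have ih := ih fun g hg => hw g (List.mem_cons_of_mem _ hg)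
    intro n h
    cases b with
    | true =>
      rw [List.foldl_cons, counterAct_self_true] at h
      simpa [List.replicate_succ'] using ih _ h
    | false =>
      cases n with
      | zero =>
        rw [List.foldl_cons, counterAct_self_false_zero] at h
        have : ∀ w : List (V × Bool), w.foldl (counterAct u) none = none := by
          intro w
          induction w with
          | nil => rfl
          | cons g w ih => rw [List.foldl_cons, counterAct_none, ih]
        simp [this] at h
      | succ n =>
        rw [List.foldl_cons, counterAct_self_false_succ] at h
        have := (ih _ h).insert (z := [(u, true), (u, false)]) rfl
        simpa [List.replicate_succ'] using this

theorem pathSemilinear_of_subsingleton [Finite V] (hirr : ∀ v, ¬ E v v) {U : Set V}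
    (hU : U.Subsingleton) (hl : ∀ v ∈ U, ¬ Loop v) : PathSemilinear E Loop U := by
  classical
  intro Q T _ _ Δ hΔ hlab
  have hsym := isSemilinearSet_symbolic hΔ
  set e : Q × Q → ((Q × Q) ⊕ T → ℕ) := fun n => Pi.single (.inl n) 1 with he
  set S : Q × Q → Set ((Q × Q) ⊕ T → ℕ) := fun n =>
    {f | f = 0 ∧ n.1 = n.2} ∪
    (⋃ r, {f | ∃ f₁, symbolic Δ n.1 none f₁ r ∧ f = f₁ + e (r, n.2)}) ∪
    ⋃ (v : V) (r : Q) (s : Q), {f | ∃ f₁ f₂, symbolic Δ n.1 (some (v, true)) f₁ r ∧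
      symbolic Δ s (some (v, false)) f₂ n.2 ∧ f = f₁ + (e (r, s) + f₂)} with hS
  have hjump : ∀ r s, symbolic Δ r none (e (r, s)) s := fun r s => .inr ⟨rfl, rfl⟩
  refine isSemilinearSet_of_insertion (wordVal E Loop) rfl wordVal_append
    (W := {z | ∃ v, z = [(v, true), (v, false)]}) (S := S) ?_ ?_ ?_ ?_
  · intro p w v q hw h1
    have hw := hw.letters_mem (U := {g | g.1 ∈ U}) hlab
    cases w with
    | nil => exact .nil
    | cons g w =>
      have hg : g.1 ∈ U := hw g (by simp)
      have := insertion_of_counterAct (v := g.1) (w := g :: w) (fun g' hg' => hU (hw g' hg') hg)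
        0 (counterAct_foldl hirr (hl _ hg) (y := []) h1 _)
      refine (show ∀ {W W' : Set (List (V × Bool))} {w}, Insertion W w → W ⊆ W' →
        Insertion W' w from ?_) this (by rintro _ rfl; exact ⟨_, rfl⟩)
      intro W W' w h hW
      induction h with
      | nil => exact .nil
      | insert _ hz ih => exact ih.insert (hW hz)
  · rintro ⟨p, q⟩
    refine (IsSemilinearSet.union ?_ (.iUnion fun r => ?_)).union
      (.iUnion fun v => .iUnion fun r => .iUnion fun s => ?_)
    · by_cases h : p = q <;> simp [h]
    · convert (hsym p none r).add (.singleton (e (r, q))) using 1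
      ext f
      simp [eq_comm]
    · convert (hsym p (some (v, true)) r).add ((IsSemilinearSet.singleton (e (r, s))).add
        (hsym s (some (v, false)) q)) using 1
      ext f
      simp [Set.mem_add, eq_comm]
  · rintro p q f ((⟨rfl, h⟩ | h) | h)
    · obtain rfl : p = q := h
      exact ⟨[], .nil p, rfl⟩
    · obtain ⟨r, f₁, h₁, rfl⟩ := Set.mem_iUnion.1 h
      exact ⟨[], (Path.epsilon h₁).append (.epsilon (hjump _ _)), rfl⟩
    · simp only [Set.mem_iUnion] at h
      obtain ⟨v, r, s, f₁, f₂, h₁, h₂, rfl⟩ := h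
      exact ⟨_, (Path.letter h₁).append ((Path.epsilon (hjump _ _)).append (.letter h₂)),
        wordVal_mul_bar v⟩
  · intro X hX
    have heps : ∀ {p v q}, Path (withJumps Δ X) p [] v q → v ∈ X (p, q) := by
      intro p v q h
      generalize hz : ([] : List (V × Bool)) = z at h
      induction h with
      | nil p => exact hX (p, p) 0 (.inl (.inl ⟨rfl, rfl⟩)) 0 .zero
      | @cons p r q o w v v' hd _ ih =>
        obtain ⟨ho, rfl⟩ := List.append_eq_nil_iff.1 hz.symm
        obtain rfl : o = none := by simpa using ho
        obtain ⟨f, hf, hfv⟩ := exists_symbolic_of_withJumps hd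
        exact hX (p, q) (f + e (r, q)) (.inl (.inr (Set.mem_iUnion.2 ⟨r, f, hf, rfl⟩))) _
          (hfv.add (Subst.single (X := terminalFamily X) (j := .inl (_, _)) (ih rfl)))
    rintro p q z v (rfl | ⟨u, rfl⟩) h
    · exact heps h
    · obtain ⟨r, r', v₁, v₂, v₃, h₁, h₂, h₃, rfl⟩ := h.split_cons
      obtain ⟨s, s', v₄, v₅, v₆, h₄, h₅, h₆, rfl⟩ := h₃.split_cons
      obtain ⟨f₁, hf₁, hfv₁⟩ := exists_symbolic_of_withJumps h₂
      obtain ⟨f₂, hf₂, hfv₂⟩ := exists_symbolic_of_withJumps h₅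
      have hmid : v₂ + (v₄ + v₅) ∈ X (r, s') := hX (r, s') (f₁ + (e (r', s) + f₂))
        (.inr (by simp only [Set.mem_iUnion]; exact ⟨u, r', s, f₁, f₂, hf₁, hf₂, rfl⟩)) _
        (hfv₁.add ((Subst.single (X := terminalFamily X) (j := .inl (_, _)) (heps h₄)).add hfv₂))
      have := heps (h₁.append (Path.append (.epsilon (.inr ⟨rfl, hmid⟩)) h₆))
      convert this using 1
      abel

end GraphMonoid

section FreeProduct

/-- A nonempty word representing `1` in a free product contains a nonempty block of letters from
a single factor which represents `1`. -/
theorem exists_block_of_coprodI_eq_one {ι G K : Type} [Monoid K] (side : G → ι) (f : G → K)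
    {w : List G} (hw : w ≠ [])
    (h : (w.map fun g => (Monoid.CoprodI.of (M := fun _ : ι => K) (i := side g) (f g))).prod = 1) :
    ∃ i x z y, w = x ++ z ++ y ∧ z ≠ [] ∧ (∀ g ∈ z, side g = i) ∧ (z.map f).prod = 1 := by
  classical
  by_contra! hc
  have key : ∀ n : ℕ, ∀ w' x : List G, w'.length ≤ n → w = x ++ w' →
      ∃ u : Monoid.CoprodI.Word fun _ : ι => K, u.prod =
        (w'.map fun g => (Monoid.CoprodI.of (M := fun _ : ι => K) (i := side g) (f g))).prod ∧
        u.fstIdx = w'.head?.map side := by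
    intro n
    induction n with
    | zero =>
      intro w' x hn _
      obtain rfl : w' = [] := by simpa using hn
      exact ⟨.empty, by simp, rfl⟩
    | succ n ih =>
      intro w' x hn hx
      cases w' with
      | nil => exact ⟨.empty, by simp, rfl⟩
      | cons g w' =>
        set z := w'.takeWhile fun g' => side g' = side g with hz
        set y := w'.dropWhile fun g' => side g' = side g with hy
        have hzy : z ++ y = w' := List.takeWhile_append_dropWhile
        have hzs : ∀ g' ∈ z, side g' = side g := fun g' hg' => by
          simpa using List.mem_takeWhile_imp hg'
        obtain ⟨u, hu, hui⟩ := ih y (x ++ g :: z) (by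
          have := congrArg List.length hzy
          simp at this hn
          omega) (by simp [hx, hzy])
        have hne : ((g :: z).map f).prod ≠ 1 :=
          hc (side g) x (g :: z) y (by simp [hx, hzy]) (by simp) (by simpa using hzs)
        have hidx : u.fstIdx ≠ some (side g) := by
          rw [hui]
          have := List.head?_dropWhile_not (fun g' => decide (side g' = side g)) w'
          rw [← hy] at this
          cases hh : y.head? with
          | none => simp
          | some g' => simpa [hh] using this
        refine ⟨.cons _ u hidx hne, ?_, by simp⟩
        rw [Monoid.CoprodI.Word.prod_cons, hu, ← hzy, List.map_cons, List.prod_cons, map_mul,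
          List.map_cons, List.prod_cons, List.map_append, List.prod_append, mul_assoc]
        congr 2
        clear_value z
        clear hzy hz hne hy
        induction z with
        | nil => simp
        | cons a z ih =>
          have ha : side a = side g := hzs a (by simp)
          rw [List.map_cons, List.prod_cons, map_mul, List.map_cons, List.prod_cons,
            ih fun g' hg' => hzs g' (by simp [hg']), ha]
  obtain ⟨u, hu, hui⟩ := key w.length w [] le_rfl rfl
  rw [h] at hu
  have hu' : u = .empty := by
    rw [← Monoid.CoprodI.Word.prod_empty] at hu
    exact Monoid.CoprodI.Word.equiv.symm.injective hu
  rw [hu'] at hui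
  cases w with
  | nil => exact hw rfl
  | cons g w => simp [Monoid.CoprodI.Word.fstIdx, Monoid.CoprodI.Word.empty] at hui

variable {V : Type} {E : V → V → Prop} {Loop : V → Prop}

theorem exists_block_of_wordVal_eq_one {ι : Type} {U : Set V} {side : V → ι}
    (hE : ∀ v ∈ U, ∀ w ∈ U, E v w → side v = side w) {w : List (V × Bool)}
    (hU : ∀ g ∈ w, g.1 ∈ U) (hw : w ≠ []) (h : wordVal E Loop w = 1) :
    ∃ i x z y, w = x ++ z ++ y ∧ z ≠ [] ∧ (∀ g ∈ z, side g.1 = i) ∧ wordVal E Loop z = 1 := by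
  classical
  set φ := liftHom (E := E) (Loop := Loop) (fun g => if g.1 ∈ U then
      Monoid.CoprodI.of (M := fun _ : ι => MGraph V E Loop) (i := side g.1) (wordVal E Loop [g])
      else 1)
    (fun v => by
      by_cases hv : v ∈ U
      · simp [hv, ← map_mul, wordVal_mul_bar]
      · simp [hv])
    (fun v hl => by
      by_cases hv : v ∈ U
      · simp [hv, ← map_mul, wordVal_bar_mul hl]
      · simp [hv])
    (fun v w s t hvw => by
      by_cases hv : v ∈ U
      · by_cases hw : w ∈ U
        · simp only [hv, hw, if_true, hE v hv w hw hvw, ← map_mul]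
          rw [(wordVal_commute hvw s t).eq]
        · simp [hw]
      · simp [hv]) with hφ
  have h1 := congrArg φ h
  rw [hφ, liftHom_wordVal, map_one, List.map_congr_left (g := fun g =>
    Monoid.CoprodI.of (M := fun _ : ι => MGraph V E Loop) (i := side g.1) (wordVal E Loop [g]))
    fun g hg => by simp [hU g hg]] at h1
  obtain ⟨i, x, z, y, h2, h3, h4, h5⟩ :=
    exists_block_of_coprodI_eq_one (fun g : V × Bool => side g.1) _ hw h1
  refine ⟨i, x, z, y, h2, h3, h4, ?_⟩
  rw [← h5]
  clear * -
  induction z with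
  | nil => rfl
  | cons g z ih => rw [wordVal_cons, ih]; rfl

theorem pathSemilinear_iUnion {ι : Type} [Finite ι] [Nonempty ι] {U : ι → Set V} (side : V → ι)
    (hside : ∀ i, ∀ v ∈ U i, side v = i)
    (hE : ∀ v w, (∃ i, v ∈ U i) → (∃ i, w ∈ U i) → E v w → side v = side w)
    (hU : ∀ i, PathSemilinear E Loop (U i)) : PathSemilinear E Loop (⋃ i, U i) := by
  intro Q T _ _ Δ hΔ hlab
  simp only [Set.mem_iUnion] at hlab
  set Δ' : ι → Q → Option (V × Bool) → (T → ℕ) → Q → Prop :=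
    fun i p o v q => (∀ g ∈ o, g.1 ∈ U i) ∧ Δ p o v q with hΔ'
  have hsymlab : ∀ i p g f q, symbolic (Δ' i) p (some g) f q → g.1 ∈ U i := by
    rintro i p g f q (⟨v, h, -⟩ | ⟨h, -⟩)
    · exact h.1 g rfl
    · cases h
  refine isSemilinearSet_of_insertion (wordVal E Loop) rfl wordVal_append
    (W := {z | wordVal E Loop z = 1 ∧ ∃ i, ∀ g ∈ z, g.1 ∈ U i})
    (S := fun n => ⋃ i, {f | ∃ z, Path (symbolic (Δ' i)) n.1 z f n.2 ∧ wordVal E Loop z = 1})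
    ?_ ?_ ?_ ?_
  · intro p w v q hw
    have hw := hw.letters_mem (U := {g | ∃ i, g.1 ∈ U i}) hlab
    clear * - hw hE hside
    induction hn : w.length using Nat.strong_induction_on generalizing w with
    | _ n ih =>
      intro h1
      rcases eq_or_ne w [] with rfl | hne
      · exact .nil
      obtain ⟨i, x, z, y, rfl, hz, hzi, hz1⟩ := exists_block_of_wordVal_eq_one (E := E)
        (U := {v | ∃ i, v ∈ U i}) (side := side) (fun v hv w hw => hE v w hv hw) hw hne h1
      refine .insert (ih (x ++ y).length ?_ (x ++ y) (fun g hg => hw g ?_) rfl ?_)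
        ⟨hz1, i, fun g hg => ?_⟩
      · have := List.length_pos_of_ne_nil hz
        simp at hn ⊢
        omega
      · simp at hg ⊢
        tauto
      · simpa [wordVal_append, hz1] using h1
      · obtain ⟨j, hj⟩ := hw g (by simp [hg])
        rwa [← hzi g hg, hside j _ hj]
  · rintro ⟨p, q⟩
    refine .iUnion fun i => hU i Q _ (symbolic (Δ' i)) (fun p o q => ?_) (hsymlab i) p q
    refine isSemilinearSet_symbolic (fun p o q => ?_) p o q
    by_cases ho : ∀ g ∈ o, g.1 ∈ U i
    · convert hΔ p o q using 1
      ext v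
      exact ⟨fun h => h.2, fun h => ⟨ho, h⟩⟩
    · convert IsSemilinearSet.empty using 1
      ext v
      simp only [Set.mem_ofPred_eq, Set.mem_empty_iff_false, iff_false]
      exact fun h => ho h.1
  · rintro p q f hf
    obtain ⟨i, z, hz, h1⟩ := Set.mem_iUnion.1 hf
    refine ⟨z, hz.mono ?_, h1⟩
    rintro p o v q - (⟨u, h, rfl⟩ | h)
    · exact .inl ⟨u, h.2, rfl⟩
    · exact .inr h
  · intro X hX p q z v hz h
    obtain ⟨hz1, i, hi⟩ : wordVal E Loop z = 1 ∧ ∃ i, ∀ g ∈ z, g.1 ∈ U i := by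
      rcases hz with rfl | hz
      · exact ⟨rfl, Classical.arbitrary ι, by simp⟩
      · exact hz
    have h' : Path (withJumps (Δ' i) X) p z v q := h.mono fun p o v q ho hd => by
      rcases hd with hd | hd
      · exact .inl ⟨fun g hg => hi g (ho g hg), hd⟩
      · exact .inr hd
    obtain ⟨f, hf, hfv⟩ := h'.exists_symbolic
    exact hX (p, q) f (Set.mem_iUnion.2 ⟨i, z, hf, hz1⟩) v hfv

end FreeProduct

section LoopedUniversal

variable {V : Type} {E : V → V → Prop} {Loop : V → Prop}

open Classical in
theorem wordVal_eq_filter_mul {u : V} {w : List (V × Bool)} (hu : Loop u)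
    (hE : ∀ g ∈ w, g.1 ≠ u → E g.1 u) :
    wordVal E Loop w = wordVal E Loop (w.filter fun g => g.1 ≠ u) *
      (wordVal E Loop [(u, true)] ^ w.count (u, true) *
        wordVal E Loop [(u, false)] ^ w.count (u, false)) := by
  have hz : Commute (wordVal E Loop [(u, true)]) (wordVal E Loop [(u, false)]) :=
    (wordVal_mul_bar u).trans (wordVal_bar_mul hu).symm
  have hcomm : ∀ (b : Bool) (x : List (V × Bool)), (∀ g ∈ x, E g.1 u) →
      Commute (wordVal E Loop [(u, b)]) (wordVal E Loop x) := by
    intro b x hx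
    induction x with
    | nil => exact Commute.one_right _
    | cons g x ih =>
      rw [wordVal_cons]
      exact (wordVal_commute (hx g (by simp)) g.2 b).symm.mul_right
        (ih fun g hg => hx g (by simp [hg]))
  induction w with
  | nil => simp [wordVal_nil]
  | cons g w ih =>
    obtain ⟨v, b⟩ := g
    rw [wordVal_cons, ih fun g hg => hE g (by simp [hg])]
    by_cases hv : v = u
    · subst hv
      have h := hcomm b (w.filter fun g => g.1 ≠ v) fun g hg => by
        simp only [List.mem_filter, decide_eq_true_eq] at hg
        exact hE g (by simp [hg.1]) hg.2
      rw [← mul_assoc, h.eq, mul_assoc]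
      cases b
      · simp [pow_succ', ← mul_assoc, (hz.pow_left _).eq]
      · simp [pow_succ', ← mul_assoc]
    · simp [hv, wordVal_cons (v, b) (List.filter _ w), mul_assoc]

open Classical in
theorem wordVal_eq_one_iff_filter {u : V} {w : List (V × Bool)} (hu : Loop u)
    (hE : ∀ g ∈ w, g.1 ≠ u → E g.1 u) :
    wordVal E Loop w = 1 ↔
      wordVal E Loop (w.filter fun g => g.1 ≠ u) = 1 ∧ w.count (u, true) = w.count (u, false) := by
  constructor
  · intro h
    constructor
    · set φ := liftHom (E := E) (Loop := Loop)
        (fun g => if g.1 = u then 1 else wordVal E Loop [g])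
        (fun v => by by_cases hv : v = u <;> simp [hv, wordVal_mul_bar])
        (fun v hl => by by_cases hv : v = u <;> simp [hv, wordVal_bar_mul hl])
        (fun v w s t hvw => by
          by_cases hv : v = u
          · simp [hv]
          · by_cases hw : w = u
            · simp [hw]
            · simpa [hv, hw] using (wordVal_commute hvw s t).eq) with hφ
      have h1 := congrArg φ h
      rw [hφ, liftHom_wordVal, map_one] at h1
      rw [← h1]
      clear * -
      induction w with
      | nil => rfl
      | cons g w ih =>
        by_cases hg : g.1 = u
        · simp [hg, ← ih]
        · simp [hg, ← ih, wordVal_cons g (List.filter _ w)]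
    · set φ := liftHom (E := E) (Loop := Loop)
        (fun g => if g.1 = u then Multiplicative.ofAdd (if g.2 then (1 : ℤ) else -1) else 1)
        (fun v => by by_cases hv : v = u <;> simp [hv])
        (fun v hl => by by_cases hv : v = u <;> simp [hv])
        (fun v w s t hvw => mul_comm _ _) with hφ
      have h1 := congrArg φ h
      rw [hφ, liftHom_wordVal, map_one] at h1
      have key : (w.map fun g : V × Bool => if g.1 = u then
          Multiplicative.ofAdd (if g.2 then (1 : ℤ) else -1) else 1).prod.toAdd =
          (w.count (u, true) : ℤ) - w.count (u, false) := by
        clear * -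
        induction w with
        | nil => simp
        | cons g w ih =>
          obtain ⟨v, b⟩ := g
          rw [List.map_cons, List.prod_cons, toAdd_mul, ih]
          by_cases hv : v = u
          · cases b <;> simp [hv] <;> ring
          · simp [hv]
      rw [h1, toAdd_one] at key
      omega
  · rintro ⟨h1, h2⟩
    rw [wordVal_eq_filter_mul hu hE, h1, one_mul, h2]
    exact pow_mul_pow_eq_one _ (wordVal_mul_bar u)

variable {Q T : Type}

open Classical in
/-- The automaton obtained from `Δ` by erasing the letters of the vertex `u` and counting them
in two additional coordinates of the weight. -/
def eraseVertex (u : V) (Δ : Q → Option (V × Bool) → (T → ℕ) → Q → Prop) :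
    Q → Option (V × Bool) → (Bool ⊕ T → ℕ) → Q → Prop :=
  fun p o f q => (∃ v, Δ p o v q ∧ (∀ g ∈ o, g.1 ≠ u) ∧ f = terminalHom Bool T v) ∨
    (o = none ∧ ∃ b v, Δ p (some (u, b)) v q ∧ f = Pi.single (.inl b) 1 + terminalHom Bool T v)

open Classical in
theorem Path.eraseVertex {u : V} {Δ : Q → Option (V × Bool) → (T → ℕ) → Q → Prop} {p q : Q}
    {w : List (V × Bool)} {v : T → ℕ} (h : Path Δ p w v q) :
    Path (eraseVertex u Δ) p (w.filter fun g => g.1 ≠ u)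
      (Sum.elim (fun b => w.count (u, b)) v) q := by
  induction h with
  | nil p =>
    have : Sum.elim (fun b => List.count (u, b) ([] : List (V × Bool))) (0 : T → ℕ) = 0 := by ext (b | t) <;> simp
    rw [this]
    exact .nil p
  | @cons p r q o w v v' hd _ ih =>
    by_cases ho : ∀ g ∈ o, g.1 ≠ u
    · convert cons (.inl ⟨v, hd, ho, rfl⟩) ih using 1
      · cases o with
        | none => simp
        | some g => simp [ho g rfl]
      · ext (b | t)
        · cases o with
          | none => simp [terminalHom]
          | some g =>
            have : g ≠ (u, b) := by rintro rfl; exact ho _ rfl rfl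
            simp [terminalHom, List.count_cons, this]
        · simp [terminalHom]
    · push Not at ho
      obtain ⟨⟨u', b⟩, rfl, rfl⟩ := ho
      convert cons (.inr ⟨rfl, b, v, hd, rfl⟩) ih using 1
      · simp
      · ext (b' | t)
        · cases b <;> cases b' <;> simp [terminalHom, add_comm]
        · simp [terminalHom]

open Classical in
theorem Path.of_eraseVertex {u : V} {Δ : Q → Option (V × Bool) → (T → ℕ) → Q → Prop} {p q : Q}
    {z : List (V × Bool)} {f : Bool ⊕ T → ℕ} (h : Path (Paper.eraseVertex u Δ) p z f q) :
    ∃ w v, Path Δ p w v q ∧ w.filter (fun g => g.1 ≠ u) = z ∧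
      f = Sum.elim (fun b => w.count (u, b)) v := by
  induction h with
  | nil p => exact ⟨[], 0, .nil p, rfl, by ext (b | t) <;> simp⟩
  | @cons p r q o w v v' hd _ ih =>
    obtain ⟨w, x, hp, rfl, rfl⟩ := ih
    rcases hd with ⟨y, hd, ho, rfl⟩ | ⟨rfl, b, y, hd, rfl⟩
    · refine ⟨_, _, cons hd hp, ?_, ?_⟩
      · cases o with
        | none => simp
        | some g => simp [ho g rfl]
      · ext (b | t)
        · cases o with
          | none => simp [terminalHom]
          | some g =>
            have : g ≠ (u, b) := by rintro rfl; exact ho _ rfl rfl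
            simp [terminalHom, List.count_cons, this]
        · simp [terminalHom]
    · refine ⟨_, _, cons hd hp, by simp, ?_⟩
      ext (b' | t)
      · cases b <;> cases b' <;> simp [terminalHom, add_comm]
      · simp [terminalHom]

theorem pathSemilinear_of_looped_universal {U : Set V} {u : V} (hu : Loop u)
    (hE : ∀ v ∈ U, v ≠ u → E v u) (hU : PathSemilinear E Loop (U \ {u})) :
    PathSemilinear E Loop U := by
  classical
  intro Q T _ _ Δ hΔ hlab p q
  have h1 := hU Q (Bool ⊕ T) (eraseVertex u Δ) (fun p o q => by
    refine IsSemilinearSet.union (s₁ := {f | ∃ v, Δ p o v q ∧ (∀ g ∈ o, g.1 ≠ u) ∧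
        f = terminalHom Bool T v})
      (s₂ := {f | o = none ∧ ∃ b v, Δ p (some (u, b)) v q ∧
        f = Pi.single (.inl b) 1 + terminalHom Bool T v}) ?_ ?_
    · by_cases ho : ∀ g ∈ o, g.1 ≠ u
      · convert (hΔ p o q).image (terminalHom Bool T) using 1
        ext f
        simp only [Set.mem_ofPred_eq, Set.mem_image]
        exact ⟨fun ⟨v, h, _, e⟩ => ⟨v, h, e.symm⟩, fun ⟨v, h, e⟩ => ⟨v, h, ho, e.symm⟩⟩
      · convert IsSemilinearSet.empty using 1
        ext f
        simp only [Set.mem_ofPred_eq, Set.mem_empty_iff_false, iff_false]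
        exact fun ⟨_, _, h, _⟩ => ho h
    · by_cases ho : o = none
      · convert IsSemilinearSet.iUnion fun b : Bool =>
          ((hΔ p (some (u, b)) q).image (terminalHom Bool T)).vadd
            (Pi.single (.inl b) 1 : Bool ⊕ T → ℕ) using 1
        ext f
        simp [ho, Set.mem_vadd_set, eq_comm]
      · simp [ho])
    (by
      rintro p g v q (⟨v, h, hg, -⟩ | ⟨h, -⟩)
      · exact ⟨hlab _ _ _ _ h, hg g rfl⟩
      · cases h) p q
  convert (h1.inter (isSemilinearSet_setOfPred_eq 0 0
    (Pi.evalAddMonoidHom (fun _ : Bool ⊕ T => ℕ) (.inl true))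
    (Pi.evalAddMonoidHom (fun _ : Bool ⊕ T => ℕ) (.inl false)))).image
    (AddMonoidHom.pi fun t => Pi.evalAddMonoidHom (fun _ : Bool ⊕ T => ℕ) (.inr t)) using 1
  have hiff : ∀ {w v}, Path Δ p w v q → (wordVal E Loop w = 1 ↔ _) := fun h =>
    wordVal_eq_one_iff_filter hu fun g hg =>
      hE g.1 (Path.letters_mem (U := {g : V × Bool | g.1 ∈ U}) hlab h g hg)
  ext v
  constructor
  · rintro ⟨w, hw, h⟩
    obtain ⟨h1, h2⟩ := (hiff hw).1 h
    exact ⟨_, ⟨⟨_, hw.eraseVertex, h1⟩, by simpa using h2⟩, rfl⟩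
  · rintro ⟨f, ⟨⟨z, hz, h1⟩, h2⟩, rfl⟩
    obtain ⟨w, v, hw, rfl, rfl⟩ := hz.of_eraseVertex
    exact ⟨w, hw, (hiff hw).2 ⟨h1, by simpa using h2⟩⟩

end LoopedUniversal

section Sufficiency

variable {V : Type} {E : V → V → Prop} {Loop : V → Prop}

theorem pathSemilinear_of_forbidden [Finite V] (hsymm : ∀ v w, E v w → E w v)
    (hirr : ∀ v, ¬ E v v)
    (h₁ : ∀ v w, E v w → Loop v ∨ Loop w)
    (h₂ : ∀ u v w, u ≠ w → ¬ Loop v → Loop u → Loop w → E v u → E v w → E u w)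
    (h₃ : ∀ a b c d, a ≠ c → b ≠ d → a ≠ d → E a b → E b c → E c d → E a c ∨ E b d)
    (U : Finset V) : PathSemilinear E Loop U := by
  classical
  induction hn : U.card using Nat.strong_induction_on generalizing U with
  | _ n ih =>
    rcases U.eq_empty_or_nonempty with rfl | hne
    · exact pathSemilinear_of_subsingleton hirr (by simp) (by simp)
    obtain ⟨v, hv, hmax⟩ := U.exists_max_image (fun v => (U.filter (E v)).card) hne
    have hloop : ∀ u ∈ U, Loop u → (∀ w ∈ U, w ≠ u → E w u) → PathSemilinear E Loop U := by
      intro u hu hl hE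
      refine pathSemilinear_of_looped_universal hl (by simpa using hE) ?_
      rw [← Finset.coe_erase]
      exact ih _ (hn ▸ Finset.card_erase_lt_of_mem hu) _ rfl
    by_cases hU : ∀ w ∈ U, w ≠ v → E v w
    · by_cases hl : Loop v
      · exact hloop v hv hl fun w hw hne => hsymm _ _ (hU w hw hne)
      · by_cases hw : ∃ w ∈ U, w ≠ v
        · obtain ⟨w, hw, hwv⟩ := hw
          have hlU : ∀ x ∈ U, x ≠ v → Loop x := fun x hx hxv =>
            (h₁ v x (hU x hx hxv)).resolve_left hl
          refine hloop w hw (hlU w hw hwv) fun x hx hxw => ?_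
          rcases eq_or_ne x v with rfl | hxv
          · exact hU w hw hwv
          · exact h₂ x v w hxw hl (hlU x hx hxv) (hlU w hw hwv) (hU x hx hxv) (hU w hw hwv)
        · push Not at hw
          refine pathSemilinear_of_subsingleton hirr ?_ fun u hu => hw u hu ▸ hl
          exact fun a ha b hb => (hw a ha).trans (hw b hb).symm
    · push Not at hU
      obtain ⟨y₀, hy₀, hyv, hvy⟩ := hU
      set S : Bool → Finset V := fun b => U.filter fun w => decide (w = v ∨ E v w) = b with hS
      have hUS : (U : Set V) = ⋃ b, (S b : Set V) := by
        ext w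
        simp [hS]
      have hE : ∀ x ∈ U, ∀ y ∈ U, (x = v ∨ E v x) → ¬ (y = v ∨ E v y) → ¬ E x y := by
        intro x hx y hy hxv hyv hxy
        have hxv' : x ≠ v := by rintro rfl; exact hyv (.inr hxy)
        replace hxv := hxv.resolve_left hxv'
        push Not at hyv
        obtain ⟨z, hz, hzx⟩ : ∃ z ∈ U.filter (E v), z ∉ insert x (U.filter (E x)) := by
          by_contra! hsub
          have hle : insert y (insert v ((U.filter (E v)).erase x)) ⊆ U.filter (E x) := by
            intro z hz
            simp only [Finset.mem_insert, Finset.mem_erase] at hz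
            rcases hz with rfl | rfl | ⟨hzx, hz⟩
            · simp [hy, hxy]
            · simp [hv, hsymm _ _ hxv]
            · exact (Finset.mem_insert.1 (hsub z hz)).resolve_left hzx
          have hcard := Finset.card_le_card hle
          rw [Finset.card_insert_of_notMem (by simp [hyv]),
            Finset.card_insert_of_notMem (by simp [hirr]),
            Finset.card_erase_of_mem (by simp [hx, hxv])] at hcard
          have := hmax x hx
          omega
        simp only [Finset.mem_filter, Finset.mem_insert, not_or, not_and] at hz hzx
        rcases h₃ z v x y hzx.1 hyv.1.symm (by rintro rfl; exact hyv.2 hz.2) (hsymm _ _ hz.2) hxv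
          hxy with h | h
        · exact hzx.2 hz.1 (hsymm _ _ h)
        · exact hyv.2 h
      rw [hUS]
      refine pathSemilinear_iUnion (fun w => decide (w = v ∨ E v w)) ?_ ?_ ?_
      · simp [hS]
      · rintro x y ⟨b, hx⟩ ⟨b', hy⟩ hxy
        replace hx := (Finset.mem_filter.1 hx).1
        replace hy := (Finset.mem_filter.1 hy).1
        refine decide_eq_decide.2 ⟨fun h => ?_, fun h => ?_⟩
        · by_contra h'
          exact hE x hx y hy h h' hxy
        · by_contra h'
          exact hE y hy x hx h h' (hsymm _ _ hxy)
      · intro b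
        refine ih _ ?_ _ rfl
        rw [← hn]
        refine Finset.card_lt_card (Finset.filter_ssubset.2 ?_)
        cases b
        · exact ⟨v, hv, by simp⟩
        · exact ⟨y₀, hy₀, by simp [hyv, hvy]⟩

theorem isSemilinearSet_of_root {X : Type} {S : Set (X → ℕ)} (h : _root_.IsSemilinearSet S) :
    IsSemilinearSet S := by
  obtain ⟨F, hF, hlin, rfl⟩ := h
  obtain ⟨n, T, -, rfl⟩ := hF.fin_param
  refine ⟨n, T, fun i => ?_, Set.sUnion_range T⟩
  obtain ⟨a, k, f, hf⟩ := isLinearSet_iff_exists_fin_addMonoidHom.1 (hlin _ ⟨i, rfl⟩)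
  refine ⟨a, k, fun j => f (Pi.single j 1), ?_⟩
  have hsum : ∀ m : Fin k → ℕ, f m = ∑ j, m j • f (Pi.single j 1) := by
    intro m
    conv_lhs => rw [pi_eq_sum_univ' m]
    rw [map_sum]
    refine Finset.sum_congr rfl fun j _ => ?_
    rw [map_nsmul]
  rw [hf]
  ext β
  simp only [Set.mem_vadd_set, Set.exists_range_iff, Set.mem_ofPred_eq, ← hsum, vadd_eq_add]
  exact exists_congr fun _ => eq_comm

open Classical in
theorem parikh_cons {X : Type} (x : X) (w : List X) :
    parikh (x :: w) = Pi.single x 1 + parikh w := by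
  ext y
  by_cases h : y = x
  · simp [parikh, h, add_comm]
  · simp [parikh, h, Ne.symm h]

theorem parikh_append {X : Type} (x y : List X) : parikh (x ++ y) = parikh x + parikh y := by
  ext
  simp only [parikh, Pi.add_apply, List.count_append]

variable {Y σ : Type}

open Classical in
/-- The automaton that simulates the deterministic automaton `M`, after each letter `y` reading
the word `ω y` letter by letter and counting the occurrences of `y`. -/
def expandAutomaton {G : Type} (M : DFA Y σ) (ω : Y → List G) (N : ℕ) :
    σ × {l : List G // l.length ≤ N} → Option G → (Y → ℕ) → σ × {l : List G // l.length ≤ N} →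
      Prop
  | (q, l), some g, v, (q', l') => q' = q ∧ l.1 = g :: l'.1 ∧ v = 0
  | (q, l), none, v, (q', l') =>
      l.1 = [] ∧ ∃ y, q' = M.step q y ∧ l'.1 = ω y ∧ v = Pi.single y 1

theorem expandAutomaton_path_iff {G : Type} {M : DFA Y σ} {ω : Y → List G} {N : ℕ}
    (hN : ∀ y, (ω y).length ≤ N) {q r : σ} {w : List G} {v : Y → ℕ} :
    Path (expandAutomaton M ω N) (q, ⟨[], N.zero_le⟩) w v (r, ⟨[], N.zero_le⟩) ↔
      ∃ ys, r = M.evalFrom q ys ∧ w = ys.flatMap ω ∧ v = parikh ys := by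
  constructor
  · suffices ∀ p p' w v, Path (expandAutomaton M ω N) p w v p' → p' = (r, ⟨[], N.zero_le⟩) →
        ∃ ys, r = M.evalFrom p.1 ys ∧ w = p.2.1 ++ ys.flatMap ω ∧ v = parikh ys from
      fun h => this _ _ _ _ h rfl
    intro p p' w v h
    induction h with
    | nil p =>
      rintro rfl
      exact ⟨[], rfl, rfl, rfl⟩
    | @cons p p' p'' o w v v' hd _ ih =>
      intro hp
      obtain ⟨ys, rfl, rfl, rfl⟩ := ih hp
      obtain ⟨q, l, hl⟩ := p
      obtain ⟨q', l', hl'⟩ := p'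
      cases o with
      | none =>
        obtain ⟨rfl, y, rfl, rfl, rfl⟩ := hd
        exact ⟨y :: ys, by simp, by simp, (parikh_cons y ys).symm⟩
      | some g =>
        obtain ⟨rfl, rfl, rfl⟩ := hd
        exact ⟨ys, rfl, rfl, by simp⟩
  · rintro ⟨ys, rfl, rfl, rfl⟩
    have hread : ∀ (l : List G) (hl : l.length ≤ N) (q : σ),
        Path (expandAutomaton M ω N) (q, ⟨l, hl⟩) l 0 (q, ⟨[], N.zero_le⟩) := by
      intro l
      induction l with
      | nil => exact fun _ _ => .nil _
      | cons g l ih =>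
        intro hl q
        have := Path.cons (Δ := expandAutomaton M ω N) (p := (q, ⟨g :: l, hl⟩)) (o := some g)
          (q := (q, ⟨l, (Nat.le_succ _).trans hl⟩)) (v := 0) ⟨rfl, rfl, rfl⟩ (ih _ q)
        simpa using this
    induction ys generalizing q with
    | nil => exact .nil _
    | cons y ys ih =>
      have := Path.cons (Δ := expandAutomaton M ω N) (p := (q, ⟨[], N.zero_le⟩)) (o := none)
        ⟨rfl, y, rfl, rfl, rfl⟩ ((hread (ω y) (hN y) (M.step q y)).append ih)
      simpa [parikh_cons] using this

theorem langSemilinear_of_pathSemilinear [Finite V] (h : PathSemilinear E Loop Set.univ)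
    {X : Type} [Finite X] {L : Language X} (hL : VA (MGraph V E Loop) L) : LangSemilinear L := by
  classical
  obtain ⟨Y, _, R, φ, θ, ⟨σ, _, M, rfl⟩, rfl⟩ := hL
  choose ω hω using fun y => wordVal_surjective (E := E) (Loop := Loop) (φ (FreeMonoid.of y))
  set N := Finset.univ.sup fun y => (ω y).length with hN
  have hNy : ∀ y, (ω y).length ≤ N := fun y =>
    Finset.le_sup (f := fun y => (ω y).length) (Finset.mem_univ y)
  have : Finite {l : List (V × Bool) // l.length ≤ N} := (List.finite_length_le _ N).to_subtype
  have hval : ∀ ys : List Y, wordVal E Loop (ys.flatMap ω) = φ (FreeMonoid.ofList ys) := by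
    intro ys
    induction ys with
    | nil => exact (map_one φ).symm
    | cons y ys ih => rw [List.flatMap_cons, wordVal_append, ih, hω, ← map_mul]; rfl
  have h1 := h _ Y (expandAutomaton M ω N) (by
    rintro ⟨q, l⟩ o ⟨q', l'⟩
    refine .of_finite ?_
    cases o with
    | none =>
      refine (Set.finite_range fun y : Y => (Pi.single y 1 : Y → ℕ)).subset ?_
      rintro _ ⟨-, y, -, -, rfl⟩
      exact ⟨y, rfl⟩
    | some g =>
      refine (Set.finite_singleton (0 : Y → ℕ)).subset ?_
      rintro _ ⟨-, -, rfl⟩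
      rfl) (fun _ _ _ _ _ => Set.mem_univ _)
  let H : (Y → ℕ) →+ (X → ℕ) :=
    { toFun := fun v => ∑ y, v y • parikh (FreeMonoid.toList (θ (FreeMonoid.of y)))
      map_zero' := by simp
      map_add' := by simp [add_smul, Finset.sum_add_distrib] }
  have h2 := (IsSemilinearSet.biUnion (Set.toFinite M.accept) fun r _ =>
    h1 (M.start, ⟨[], N.zero_le⟩) (r, ⟨[], N.zero_le⟩)).image H
  have hθ : ∀ ys : List Y, parikh (FreeMonoid.toList (θ (FreeMonoid.ofList ys))) =
      H (parikh ys) := by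
    intro ys
    induction ys with
    | nil =>
      have : parikh ([] : List Y) = 0 := by ext; simp [parikh]
      rw [this, map_zero, FreeMonoid.ofList_nil, map_one]
      ext
      simp [parikh]
    | cons y ys ih =>
      rw [parikh_cons, FreeMonoid.ofList_cons, map_mul, FreeMonoid.toList_mul, parikh_append, ih,
        map_add]
      simp [H, Pi.single_apply]
  apply isSemilinearSet_of_root
  convert h2 using 1
  ext f
  simp only [Set.mem_image, Set.mem_iUnion, Set.mem_ofPred_eq, expandAutomaton_path_iff hNy]
  constructor
  · rintro ⟨_, ⟨ys, ⟨hys, hφ⟩, rfl⟩, rfl⟩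
    exact ⟨_, ⟨_, hys, _, ⟨_, rfl, rfl, rfl⟩, (hval _).trans hφ⟩, (hθ _).symm⟩
  · rintro ⟨_, ⟨_, hr, _, ⟨ys, rfl, rfl, rfl⟩, hφ⟩, rfl⟩
    exact ⟨_, ⟨FreeMonoid.ofList ys, ⟨hr, (hval _).symm.trans hφ⟩, rfl⟩, hθ _⟩

end Sufficiency

section Machine

variable {Q G : Type}

/-- `Run Δ s q w n m` states that the machine with transitions `Δ` can go from the state `s` to the
state `q` while reading the word `w` and increasing its two outputs by `n` and `m` in total. -/
inductive Run (Δ : List (Q × List G × ℕ × ℕ × Q)) (s : Q) : Q → List G → ℕ → ℕ → Prop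
  | nil : Run Δ s s [] 0 0
  | snoc {p q : Q} {w z : List G} {n m i j : ℕ} :
      Run Δ s p w n m → (p, z, i, j, q) ∈ Δ → Run Δ s q (w ++ z) (n + i) (m + j)

open Classical in
/-- The deterministic automaton recognizing the sequences of transitions that form a path. -/
noncomputable def pathDFA (Δ : List (Q × List G × ℕ × ℕ × Q)) (s r : Q) :
    DFA {e // e ∈ Δ} (Option Q) where
  step o e := if o = some e.1.1 then some e.1.2.2.2.2 else none
  start := some s
  accept := {some r}

variable {Δ : List (Q × List G × ℕ × ℕ × Q)} {s r : Q}

theorem run_iff_pathDFA {q : Q} {w : List G} {n m : ℕ} :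
    Run Δ s q w n m ↔ ∃ ys, (pathDFA Δ s r).eval ys = some q ∧ w = ys.flatMap (fun e => e.1.2.1) ∧
      n = (ys.map fun e => e.1.2.2.1).sum ∧ m = (ys.map fun e => e.1.2.2.2.1).sum := by
  constructor
  · intro h
    induction h with
    | nil => exact ⟨[], rfl, rfl, rfl, rfl⟩
    | @snoc p q w z n m i j _ he ih =>
      obtain ⟨ys, hys, rfl, rfl, rfl⟩ := ih
      refine ⟨ys ++ [⟨_, he⟩], ?_, by simp, by simp, by simp⟩
      rw [DFA.eval_append_singleton, hys]
      simp [pathDFA]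
  · rintro ⟨ys, hys, rfl, rfl, rfl⟩
    induction ys using List.reverseRecOn generalizing q with
    | nil =>
      obtain rfl : s = q := Option.some.inj hys
      exact .nil
    | append_singleton ys e ih =>
      rw [DFA.eval_append_singleton] at hys
      obtain ⟨⟨p, z, i, j, q'⟩, he⟩ := e
      by_cases hp : (pathDFA Δ s r).eval ys = some p
      · have hq : q' = q := by
          simp only [pathDFA] at hys hp
          simpa [hp] using hys
        subst hq
        simpa using (ih hp).snoc he
      · simp [pathDFA] at hys hp
        exact absurd hys.1 hp

variable {V : Type} {E : V → V → Prop} {Loop : V → Prop}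

theorem exists_va_of_run [Finite Q] (Δ : List (Q × List (V × Bool) × ℕ × ℕ × Q)) (s r : Q) :
    ∃ L : Language Bool, VA (MGraph V E Loop) L ∧
      parikh '' L = {f | ∃ w, Run Δ s r w (f true) (f false) ∧ wordVal E Loop w = 1} := by
  classical
  have := Fintype.ofFinite Q
  let φ : FreeMonoid {e // e ∈ Δ} →* MGraph V E Loop :=
    FreeMonoid.lift fun e => wordVal E Loop e.1.2.1
  let θ : FreeMonoid {e // e ∈ Δ} →* FreeMonoid Bool := FreeMonoid.lift fun e =>
    FreeMonoid.ofList (List.replicate e.1.2.2.1 true ++ List.replicate e.1.2.2.2.1 false)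
  have hφ : ∀ ys : List {e // e ∈ Δ},
      φ (FreeMonoid.ofList ys) = wordVal E Loop (ys.flatMap fun e => e.1.2.1) := by
    intro ys
    induction ys with
    | nil => exact map_one φ
    | cons y ys ih =>
      rw [FreeMonoid.ofList_cons, map_mul, ih, List.flatMap_cons, wordVal_append]
      rfl
  have hθ : ∀ (ys : List {e // e ∈ Δ}) (b : Bool),
      parikh (FreeMonoid.toList (θ (FreeMonoid.ofList ys))) b =
        bif b then (ys.map fun e => e.1.2.2.1).sum else (ys.map fun e => e.1.2.2.2.1).sum := by
    intro ys b
    induction ys with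
    | nil => cases b <;> simp [parikh]
    | cons y ys ih =>
      rw [FreeMonoid.ofList_cons, map_mul, FreeMonoid.toList_mul, parikh_append, Pi.add_apply, ih]
      cases b <;> simp [parikh, θ, List.count_replicate]
  refine ⟨_, ⟨_, inferInstance, (pathDFA Δ s r).accepts, φ, θ, ⟨_, inferInstance, _, rfl⟩, rfl⟩, ?_⟩
  ext f
  simp only [Set.mem_image, Set.mem_ofPred_eq, run_iff_pathDFA (r := r)]
  constructor
  · rintro ⟨_, ⟨ys, ⟨hys, h1⟩, rfl⟩, rfl⟩
    exact ⟨_, ⟨FreeMonoid.toList ys, hys, rfl, hθ _ true, hθ _ false⟩, (hφ _).symm.trans h1⟩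
  · rintro ⟨_, ⟨ys, hys, rfl, ht, hf⟩, h1⟩
    refine ⟨_, ⟨FreeMonoid.ofList ys, ⟨hys, (hφ _).trans h1⟩, rfl⟩, funext fun b => ?_⟩
    cases b
    · exact (hθ ys false).trans hf.symm
    · exact (hθ ys true).trans ht.symm

theorem IsLinearSet.exists_le_mul {S : Set (Bool → ℕ)} (hS : IsLinearSet S)
    (hle : ∀ f ∈ S, f false ≤ 2 ^ (f true + 1)) : ∃ C, ∀ f ∈ S, f false ≤ C * (f true + 1) := by
  obtain ⟨α₀, n, α, rfl⟩ := hS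
  have hα : ∀ j, α j true = 0 → α j false = 0 := by
    intro j hj
    by_contra hne
    have := hle _ ⟨Pi.single j (2 ^ (α₀ true + 1) + 1), rfl⟩
    simp [Pi.single_apply, hj] at this
    have := Nat.le_mul_of_pos_right (2 ^ (α₀ true + 1) + 1) (Nat.pos_of_ne_zero hne)
    omega
  refine ⟨α₀ false + ∑ j, α j false, ?_⟩
  rintro _ ⟨m, rfl⟩
  have hj : ∀ j, m j * α j false ≤ (α₀ false + ∑ j, α j false) * (m j * α j true) := by
    intro j
    rcases Nat.eq_zero_or_pos (α j true) with h | h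
    · simp [h, hα j h]
    · have h1 : α j false ≤ ∑ j, α j false :=
        Finset.single_le_sum (f := fun j => α j false) (fun _ _ => Nat.zero_le _) (Finset.mem_univ j)
      calc m j * α j false ≤ m j * α j true * (α₀ false + ∑ j, α j false) :=
            Nat.mul_le_mul (Nat.le_mul_of_pos_right _ h) (by omega)
        _ = _ := mul_comm _ _
  have := Finset.sum_le_sum fun j (_ : j ∈ Finset.univ) => hj j
  rw [← Finset.mul_sum] at this
  simp only [Pi.add_apply, Finset.sum_apply, Pi.smul_apply, smul_eq_mul]
  nlinarith [Nat.zero_le ((α₀ false + ∑ j, α j false) * α₀ true), Nat.zero_le (∑ j, α j false)]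

theorem not_isSemilinearSet_of_exponential {S : Set (Bool → ℕ)}
    (hle : ∀ f ∈ S, f false ≤ 2 ^ (f true + 1))
    (hex : ∀ n, ∃ f ∈ S, f true = n + 1 ∧ 2 ^ n ≤ f false) : ¬ IsSemilinearSet S := by
  rintro ⟨k, T, hT, rfl⟩
  choose C hC using fun i => (hT i).exists_le_mul fun f hf => hle f (Set.mem_iUnion_of_mem i hf)
  obtain ⟨f, hf, ht, hfalse⟩ := hex (4 * ∑ i, C i)
  obtain ⟨i, hi⟩ := Set.mem_iUnion.1 hf
  have h1 := hC i f hi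
  have h2 : C i ≤ ∑ i, C i :=
    Finset.single_le_sum (f := C) (fun _ _ => Nat.zero_le _) (Finset.mem_univ i)
  generalize ∑ i, C i = K at *
  have h3 : 2 * K < 2 ^ (2 * K) := Nat.lt_two_pow_self
  have h4 : 2 ^ (4 * K) = 2 ^ (2 * K) * 2 ^ (2 * K) := by rw [← pow_add]; congr 1; ring
  have h5 : C i * (f true + 1) ≤ K * (f true + 1) := Nat.mul_le_mul_right _ h2
  rw [ht] at h1 h5
  nlinarith

theorem exists_not_langSemilinear_of_run [Finite Q] {Δ : List (Q × List (V × Bool) × ℕ × ℕ × Q)}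
    {s r : Q}
    (hle : ∀ w n m, Run Δ s r w n m → wordVal E Loop w = 1 → m ≤ 2 ^ (n + 1))
    (hex : ∀ n, ∃ w m, Run Δ s r w (n + 1) m ∧ wordVal E Loop w = 1 ∧ 2 ^ n ≤ m) :
    ∃ L : Language Bool, VA (MGraph V E Loop) L ∧ ¬ LangSemilinear L := by
  obtain ⟨L, hL, hp⟩ := exists_va_of_run (E := E) (Loop := Loop) Δ s r
  refine ⟨L, hL, ?_⟩
  rw [LangSemilinear, hp]
  refine not_isSemilinearSet_of_exponential ?_ ?_
  · rintro f ⟨w, hw, h1⟩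
    exact hle w _ _ hw h1
  · intro n
    obtain ⟨w, m, hw, h1, hm⟩ := hex n
    exact ⟨fun b => bif b then n + 1 else m, ⟨w, hw, h1⟩, rfl, hm⟩

variable (E Loop) in
/-- The machine can reach the state `q` with outputs `n` and `m`, having read a word that
represents `g`. -/
def Reach (Δ : List (Q × List (V × Bool) × ℕ × ℕ × Q)) (s q : Q) (n m : ℕ) (g : MGraph V E Loop) :
    Prop :=
  ∃ w, Run Δ s q w n m ∧ wordVal E Loop w = g

variable {Δ : List (Q × List (V × Bool) × ℕ × ℕ × Q)} {p q : Q} {n m : ℕ} {g : MGraph V E Loop}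

theorem Reach.step (h : Reach E Loop Δ s p n m g) {z : List (V × Bool)} {i j : ℕ}
    (he : (p, z, i, j, q) ∈ Δ) : Reach E Loop Δ s q (n + i) (m + j) (g * wordVal E Loop z) := by
  obtain ⟨w, hw, rfl⟩ := h
  exact ⟨_, hw.snoc he, wordVal_append _ _⟩

theorem Reach.loop (h : Reach E Loop Δ s p n m g) {z : List (V × Bool)} {i j : ℕ}
    (he : (p, z, i, j, p) ∈ Δ) (k : ℕ) :
    Reach E Loop Δ s p (n + k * i) (m + k * j) (g * wordVal E Loop z ^ k) := by
  induction k with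
  | zero => simpa using h
  | succ k ih =>
    convert ih.step he using 1
    · ring
    · ring
    · rw [pow_succ, mul_assoc]

end Machine

section Necessity

variable {V : Type} {E : V → V → Prop} {Loop : V → Prop}

open Classical in
/-- The action of the generators on pairs `(s, o)` of rational numbers, where `a` scales the first
component and `c` adds the first component to the second one. -/
noncomputable def affineAct (a c : V) (p : ℚ × ℚ) (g : V × Bool) : ℚ × ℚ :=
  if g.1 = a then (if g.2 then p.1 / 2 else 2 * p.1, p.2)
  else if g.1 = c then (p.1, if g.2 then p.2 + p.1 else p.2 - p.1)
  else p

theorem affineAct_foldl (hirr : ∀ v, ¬ E v v) {a c : V} (hac : ¬ E a c) (hca : ¬ E c a)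
    {x y : List (V × Bool)} (h : wordVal E Loop x = wordVal E Loop y) (p : ℚ × ℚ) :
    x.foldl (affineAct a c) p = y.foldl (affineAct a c) p := by
  refine foldl_eq_of_wordVal_eq _ (fun v s => ?_) (fun v _ s => ?_) (fun v w b b' hvw s => ?_) h p
  · rcases eq_or_ne v a with rfl | hv
    · simp [affineAct, mul_div_cancel₀]
    · rcases eq_or_ne v c with rfl | hv' <;> simp [affineAct, *]
  · rcases eq_or_ne v a with rfl | hv
    · simp [affineAct]
    · rcases eq_or_ne v c with rfl | hv' <;> simp [affineAct, *]
  · by_cases hv : v = a ∨ v = c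
    · have hw : w ≠ a ∧ w ≠ c := by
        constructor <;> rintro rfl <;> rcases hv with rfl | rfl <;> grind
      simp [affineAct, hw]
    · push Not at hv
      simp [affineAct, hv]

theorem wordVal_pow_mul_pow_bar (v : V) (k : ℕ) :
    wordVal E Loop [(v, true)] ^ k * wordVal E Loop [(v, false)] ^ k = 1 :=
  pow_mul_pow_eq_one k (wordVal_mul_bar v)

/-- The machine for two adjacent unlooped vertices `v` and `w`, which doubles its counters. -/
def doublingMachine (v w : V) : List (Fin 4 × List (V × Bool) × ℕ × ℕ × Fin 4) :=
  [(0, [(v, true)], 0, 0, 1), (1, [(w, false), (v, true)], 0, 0, 1), (1, [], 1, 0, 2),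
    (2, [(v, false), (w, true), (w, true)], 0, 0, 2), (2, [], 0, 0, 1), (1, [], 0, 0, 3),
    (3, [(v, false)], 0, 1, 3)]

theorem doublingMachine_invariant {v w : V} (hvw : v ≠ w) {q : Fin 4} {x : List (V × Bool)}
    {n m : ℕ} (h : Run (doublingMachine v w) 0 q x n m) :
    ∀ i j, x.foldl (counterAct v) (some 0) = some i → x.foldl (counterAct w) (some 0) = some j →
      (q = 0 → i = 0 ∧ j = 0 ∧ m = 0) ∧ (q = 1 → i + j ≤ 2 ^ n ∧ m = 0) ∧
      (q = 2 → 2 * i + j ≤ 2 ^ n ∧ m = 0) ∧ (q = 3 → i + j + m ≤ 2 ^ n) := by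
  induction h with
  | nil => simp +contextual [eq_comm]
  | @snoc p q x z n m i' j' _ he ih =>
    intro i j
    rw [List.foldl_append, List.foldl_append]
    generalize x.foldl (counterAct v) (some 0) = cv at *
    generalize x.foldl (counterAct w) (some 0) = cw at *
    have hpos : 0 < 2 ^ n := by positivity
    simp only [doublingMachine, List.mem_cons, Prod.mk.injEq, List.not_mem_nil, or_false] at he
    rcases he with ⟨rfl, rfl, rfl, rfl, rfl⟩ | ⟨rfl, rfl, rfl, rfl, rfl⟩ | ⟨rfl, rfl, rfl, rfl, rfl⟩ |
      ⟨rfl, rfl, rfl, rfl, rfl⟩ | ⟨rfl, rfl, rfl, rfl, rfl⟩ | ⟨rfl, rfl, rfl, rfl, rfl⟩ |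
      ⟨rfl, rfl, rfl, rfl, rfl⟩ <;>
    rcases cv with _ | _ | k <;> rcases cw with _ | _ | l <;>
    simp [counterAct, hvw, hvw.symm] at ih ⊢ <;> grind

theorem doublingMachine_reach {v w : V} (hvw : E v w) (n : ℕ) :
    Reach E Loop (doublingMachine v w) 0 1 n 0 (wordVal E Loop [(v, true)] ^ 2 ^ n) := by
  induction n with
  | zero =>
    have h : Reach E Loop (doublingMachine v w) 0 0 0 0 1 := ⟨_, .nil, rfl⟩
    simpa using h.step (z := [(v, true)]) (q := 1) (i := 0) (j := 0) (by simp [doublingMachine])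
  | succ n ih =>
    have h := ((((ih.step (z := []) (i := 1) (j := 0) (q := 2) (by simp [doublingMachine])).loop
      (z := [(v, false), (w, true), (w, true)]) (i := 0) (j := 0) (by simp [doublingMachine])
        (2 ^ n)).step (z := []) (i := 0) (j := 0) (q := 1) (by simp [doublingMachine])).loop
      (z := [(w, false), (v, true)]) (i := 0) (j := 0) (by simp [doublingMachine]) (2 ^ (n + 1)))
    convert h using 1
    · ring
    · ring
    · have h₁ : wordVal E Loop [(v, false), (w, true), (w, true)] =
        wordVal E Loop [(v, false)] * wordVal E Loop [(w, true)] ^ 2 := by rw [pow_two]; rfl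
      have h₂ : wordVal E Loop [(w, false), (v, true)] =
        wordVal E Loop [(w, false)] * wordVal E Loop [(v, true)] := rfl
      rw [h₁, h₂, ((wordVal_commute hvw _ _).pow_right 2).mul_pow,
        (wordVal_commute hvw _ _).symm.mul_pow, ← pow_mul, ← pow_succ', wordVal_nil, mul_one,
        mul_one, ← mul_assoc, ← mul_assoc, wordVal_pow_mul_pow_bar, one_mul,
        wordVal_pow_mul_pow_bar, one_mul]

theorem exists_not_langSemilinear_of_unlooped_edge (hirr : ∀ v, ¬ E v v) {v w : V} (hvw : E v w)
    (hv : ¬ Loop v) (hw : ¬ Loop w) :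
    ∃ L : Language Bool, VA (MGraph V E Loop) L ∧ ¬ LangSemilinear L := by
  refine exists_not_langSemilinear_of_run (Δ := doublingMachine v w) (s := 0) (r := 3) ?_ ?_
  · intro x n m hx h1
    have hne : v ≠ w := by rintro rfl; exact hirr _ hvw
    have := (doublingMachine_invariant hne hx 0 0
      (counterAct_foldl hirr hv (y := []) h1 _) (counterAct_foldl hirr hw (y := []) h1 _)).2.2.2 rfl
    rw [pow_succ]
    omega
  · intro n
    obtain ⟨x, hx, h1⟩ := ((doublingMachine_reach (Loop := Loop) hvw (n + 1)).step (z := [])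
      (i := 0) (j := 0) (q := 3) (by simp [doublingMachine])).loop (z := [(v, false)]) (i := 0)
      (j := 1) (by simp [doublingMachine]) (2 ^ (n + 1))
    refine ⟨x, _, by simpa using hx, ?_, Nat.pow_le_pow_right two_pos n.le_succ⟩
    rw [h1, wordVal_nil, mul_one, wordVal_pow_mul_pow_bar]

/-- The machine for an unlooped vertex `v` with nonadjacent looped neighbours `u` and `w`. -/
def lampMachine (u v w : V) : List (Fin 4 × List (V × Bool) × ℕ × ℕ × Fin 4) :=
  [(0, [(v, true)], 0, 0, 1), (1, [(v, false), (w, true)], 0, 0, 1), (1, [], 0, 0, 2),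
    (2, [(w, false), (v, true), (v, true)], 0, 0, 2), (2, [(u, true)], 1, 0, 1), (2, [], 0, 0, 3),
    (3, [(v, false)], 0, 1, 3), (3, [(u, false)], 0, 0, 3)]

theorem lampMachine_invariant {u v w : V} (huv : u ≠ v) (hvw : v ≠ w) (huw : u ≠ w) {q : Fin 4}
    {x : List (V × Bool)} {n m : ℕ} (h : Run (lampMachine u v w) 0 q x n m) :
    ∀ i s o, x.foldl (counterAct v) (some 0) = some i → x.foldl (affineAct u w) (1, 0) = (s, o) →
      (q = 0 → i = 0 ∧ s = 1 ∧ o = 0 ∧ m * (1 / 2) ^ n = (0 : ℚ) ∧ (1 / 2) ^ n = (1 : ℚ)) ∧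
      (q = 1 → s = (1 / 2) ^ n ∧ i * (1 / 2) ^ n + m * (1 / 2) ^ n / 2 + o ≤ 1) ∧
      (q = 2 → s = (1 / 2) ^ n ∧ (i + m) * (1 / 2) ^ n / 2 + o ≤ 1) ∧
      (q = 3 → (i + m) * (1 / 2) ^ n / 2 + o ≤ 1) := by
  induction h with
  | nil =>
    intro i s o hi hs
    simp at hi hs
    simp [← hi, ← hs]
  | @snoc p q x z n m i' j' _ he ih =>
    intro i s o
    rw [List.foldl_append, List.foldl_append]
    generalize x.foldl (counterAct v) (some 0) = cv at *
    generalize x.foldl (affineAct u w) (1, 0) = p' at *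
    obtain ⟨s', o'⟩ := p'
    have hpos : 0 < (1 / 2 : ℚ) ^ n := by positivity
    have hm : 0 ≤ m * (1 / 2 : ℚ) ^ n := by positivity
    have hmul : 0 ≤ (cv.getD 0 : ℚ) * (1 / 2) ^ n := by positivity
    simp only [lampMachine, List.mem_cons, Prod.mk.injEq, List.not_mem_nil, or_false] at he
    rcases he with ⟨rfl, rfl, rfl, rfl, rfl⟩ | ⟨rfl, rfl, rfl, rfl, rfl⟩ | ⟨rfl, rfl, rfl, rfl, rfl⟩ |
      ⟨rfl, rfl, rfl, rfl, rfl⟩ | ⟨rfl, rfl, rfl, rfl, rfl⟩ | ⟨rfl, rfl, rfl, rfl, rfl⟩ |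
      ⟨rfl, rfl, rfl, rfl, rfl⟩ | ⟨rfl, rfl, rfl, rfl, rfl⟩ <;>
    rcases cv with _ | _ | k <;>
    simp only [counterAct, affineAct, List.foldl_cons, List.foldl_nil, huv, huv.symm, hvw, hvw.symm,
      huw, huw.symm, if_true, if_false, Option.bind_some, Option.bind_none, reduceCtorEq,
      Option.some.injEq, Prod.mk.injEq, and_imp, false_imp_iff, imp_true_iff,
      forall_const, add_zero, pow_succ, Option.getD_some] at ih hm hmul ⊢ <;>
    generalize (1 / 2 : ℚ) ^ n = t at * <;> rintro rfl rfl rfl <;>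
    specialize ih _ _ _ rfl rfl rfl <;> push_cast at ih hmul ⊢ <;> grind

theorem lampMachine_reach {u v w : V} (hvu : E v u) (hvw : E v w) (n : ℕ) :
    Reach E Loop (lampMachine u v w) 0 2 n 0
      (wordVal E Loop [(u, true)] ^ n * wordVal E Loop [(v, true)] ^ 2 ^ (n + 1)) := by
  have hA : ∀ n, Reach E Loop (lampMachine u v w) 0 1 n 0
      (wordVal E Loop [(u, true)] ^ n * wordVal E Loop [(v, true)] ^ 2 ^ n) →
      Reach E Loop (lampMachine u v w) 0 2 n 0
      (wordVal E Loop [(u, true)] ^ n * wordVal E Loop [(v, true)] ^ 2 ^ (n + 1)) := by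
    intro n h
    convert (((h.loop (z := [(v, false), (w, true)]) (i := 0) (j := 0) (by simp [lampMachine])
      (2 ^ n)).step (z := []) (i := 0) (j := 0) (q := 2) (by simp [lampMachine])).loop
      (z := [(w, false), (v, true), (v, true)]) (i := 0) (j := 0) (by simp [lampMachine])
      (2 ^ n)) using 1
    · ring
    · ring
    · have h₁ : wordVal E Loop [(v, false), (w, true)] =
        wordVal E Loop [(v, false)] * wordVal E Loop [(w, true)] := rfl
      have h₂ : wordVal E Loop [(w, false), (v, true), (v, true)] =
        wordVal E Loop [(w, false)] * wordVal E Loop [(v, true)] ^ 2 := by rw [pow_two]; rfl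
      rw [h₁, h₂, ((wordVal_commute hvw _ _).symm.pow_right 2).mul_pow,
        (wordVal_commute hvw _ _).mul_pow, ← pow_mul, ← pow_succ', wordVal_nil, mul_one,
        mul_assoc, mul_assoc, ← mul_assoc (_ ^ 2 ^ n), ← mul_assoc (_ ^ 2 ^ n) (_ ^ 2 ^ n),
        wordVal_pow_mul_pow_bar, one_mul, ← mul_assoc (_ ^ 2 ^ n),
        wordVal_pow_mul_pow_bar, one_mul]
  induction n with
  | zero =>
    have h : Reach E Loop (lampMachine u v w) 0 0 0 0 1 := ⟨_, .nil, rfl⟩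
    refine hA 0 ?_
    simpa using h.step (z := [(v, true)]) (q := 1) (i := 0) (j := 0) (by simp [lampMachine])
  | succ n ih =>
    refine hA _ ?_
    convert ih.step (z := [(u, true)]) (i := 1) (j := 0) (q := 1) (by simp [lampMachine]) using 1
    rw [mul_assoc, ((wordVal_commute hvu _ _).pow_left _).eq, ← mul_assoc, ← pow_succ]

theorem exists_not_langSemilinear_of_nonadjacent_neighbors (hirr : ∀ v, ¬ E v v) {u v w : V}
    (hvu : E v u) (hvw : E v w) (huw : ¬ E u w) (hwu : ¬ E w u) (hne : u ≠ w) (hv : ¬ Loop v) :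
    ∃ L : Language Bool, VA (MGraph V E Loop) L ∧ ¬ LangSemilinear L := by
  refine exists_not_langSemilinear_of_run (Δ := lampMachine u v w) (s := 0) (r := 3) ?_ ?_
  · intro x n m hx h1
    have := (lampMachine_invariant (by rintro rfl; exact hirr _ hvu) (by rintro rfl; exact hirr _ hvw)
      hne hx 0 1 0 (counterAct_foldl hirr hv (y := []) h1 _)
      (affineAct_foldl hirr huw hwu (y := []) h1 _)).2.2.2 rfl
    have h2 : (m : ℚ) ≤ 2 ^ (n + 1) := by
      rw [one_div, inv_pow] at this
      field_simp at this
      rw [pow_succ]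
      push_cast at this
      linarith
    exact_mod_cast h2
  · intro n
    obtain ⟨x, hx, h1⟩ := (((lampMachine_reach (Loop := Loop) hvu hvw (n + 1)).step (z := [])
      (i := 0) (j := 0) (q := 3) (by simp [lampMachine])).loop (z := [(v, false)]) (i := 0)
      (j := 1) (by simp [lampMachine]) (2 ^ (n + 2))).loop (z := [(u, false)]) (i := 0)
      (j := 0) (by simp [lampMachine]) (n + 1)
    refine ⟨x, _, by simpa using hx, ?_, Nat.pow_le_pow_right two_pos (by omega)⟩
    rw [h1, wordVal_nil, mul_one, mul_assoc (_ ^ (n + 1)), wordVal_pow_mul_pow_bar, mul_one,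
      wordVal_pow_mul_pow_bar]

/-- The machine for vertices `a`, `b`, `c`, `d` that form an induced path or an induced cycle. -/
def pathMachine (a b c d : V) : List (Fin 5 × List (V × Bool) × ℕ × ℕ × Fin 5) :=
  [(0, [(a, true)], 1, 0, 1), (1, [(b, true), (c, true)], 0, 0, 1), (1, [(d, true)], 0, 0, 0),
    (0, [(d, false)], 0, 0, 2), (2, [(c, false)], 0, 1, 2), (2, [(a, false)], 0, 0, 3),
    (3, [(b, false), (b, false), (c, false)], 0, 0, 3), (3, [(d, false), (a, false)], 0, 0, 3),
    (3, [(b, false)], 0, 0, 4)]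

theorem pathMachine_invariant {a b c d : V} (hab : a ≠ b) (hac : a ≠ c) (had : a ≠ d) (hbc : b ≠ c)
    (hbd : b ≠ d) (hcd : c ≠ d) {q : Fin 5} {x : List (V × Bool)} {n m : ℕ}
    (h : Run (pathMachine a b c d) 0 q x n m) :
    ∀ s o s' o', x.foldl (affineAct a c) (1, 0) = (s, o) →
      x.foldl (affineAct d b) (1, 0) = (s', o') →
      (q = 0 → s = (1 / 2) ^ n ∧ s' = (1 / 2) ^ n ∧ o' = 2 * o ∧ m * (1 / 2) ^ n = (0 : ℚ)) ∧
      (q = 1 → s = (1 / 2) ^ n ∧ s' = 2 * (1 / 2) ^ n ∧ o' = 2 * o ∧ m * (1 / 2) ^ n = (0 : ℚ)) ∧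
      (q = 2 → s = (1 / 2) ^ n ∧ s' = 2 * s ∧ o' - 2 * o = 2 * (m * (1 / 2) ^ n)) ∧
      (q = 3 → s' = s ∧ o' - 2 * o = 2 * (m * (1 / 2) ^ n)) ∧
      (q = 4 → s' = s ∧ o' - 2 * o = 2 * (m * (1 / 2) ^ n) - s') := by
  induction h with
  | nil =>
    intro s o s' o' hs hs'
    simp at hs hs'
    simp [← hs, ← hs']
  | @snoc p q x z n m i' j' _ he ih =>
    intro s o s' o'
    rw [List.foldl_append, List.foldl_append]
    generalize x.foldl (affineAct a c) (1, 0) = r at *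
    generalize x.foldl (affineAct d b) (1, 0) = r' at *
    obtain ⟨s₁, o₁⟩ := r
    obtain ⟨s₂, o₂⟩ := r'
    specialize ih _ _ _ _ rfl rfl
    simp only [pathMachine, List.mem_cons, Prod.mk.injEq, List.not_mem_nil, or_false] at he
    rcases he with ⟨rfl, rfl, rfl, rfl, rfl⟩ | ⟨rfl, rfl, rfl, rfl, rfl⟩ | ⟨rfl, rfl, rfl, rfl, rfl⟩ |
      ⟨rfl, rfl, rfl, rfl, rfl⟩ | ⟨rfl, rfl, rfl, rfl, rfl⟩ | ⟨rfl, rfl, rfl, rfl, rfl⟩ |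
      ⟨rfl, rfl, rfl, rfl, rfl⟩ | ⟨rfl, rfl, rfl, rfl, rfl⟩ | ⟨rfl, rfl, rfl, rfl, rfl⟩ <;>
    simp only [affineAct, List.foldl_cons, List.foldl_nil, hab, hab.symm, hac, hac.symm, had,
      had.symm, hbc, hbc.symm, hbd, hbd.symm, hcd, hcd.symm, if_true, if_false, reduceCtorEq,
      Prod.mk.injEq, and_imp, add_zero, pow_succ] at ih ⊢ <;>
    generalize (1 / 2 : ℚ) ^ n = t at * <;> rintro rfl rfl rfl rfl <;>
    push_cast at ih ⊢ <;> grind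

variable (E Loop) in
/-- The element represented by the word that brings `pathMachine a b c d` back to its starting
state after `n` rounds. -/
def roundElement (a b c d : V) : ℕ → MGraph V E Loop
  | 0 => 1
  | n + 1 => roundElement a b c d n * wordVal E Loop [(a, true)] *
      wordVal E Loop [(b, true), (c, true)] ^ 2 ^ n * wordVal E Loop [(d, true)]

variable (E Loop) in
/-- A normal form of `roundElement a b c d n * b ^ 2 ^ n`. -/
def unwindElement (a b c d : V) : ℕ → MGraph V E Loop
  | 0 => wordVal E Loop [(b, true)]
  | n + 1 => unwindElement a b c d n * wordVal E Loop [(a, true)] * wordVal E Loop [(d, true)] *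
      wordVal E Loop [(c, true), (b, true), (b, true)] ^ 2 ^ n

theorem roundElement_succ {a b c d : V} (hab : E a b) (hbc : E b c) {n : ℕ}
    (h : roundElement E Loop a b c d n * wordVal E Loop [(b, true)] ^ 2 ^ n =
      unwindElement E Loop a b c d n) :
    roundElement E Loop a b c d (n + 1) = unwindElement E Loop a b c d n *
      wordVal E Loop [(a, true)] * wordVal E Loop [(c, true)] ^ 2 ^ n *
      wordVal E Loop [(d, true)] := by
  have h₁ : wordVal E Loop [(b, true), (c, true)] =
    wordVal E Loop [(b, true)] * wordVal E Loop [(c, true)] := rfl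
  rw [roundElement, h₁, (wordVal_commute hbc _ _).mul_pow, ← h, ← mul_assoc,
    mul_assoc (roundElement E Loop a b c d n), ((wordVal_commute hab _ _).pow_right _).eq,
    ← mul_assoc]

theorem roundElement_mul_pow {a b c d : V} (hab : E a b) (hbc : E b c) (hcd : E c d) (n : ℕ) :
    roundElement E Loop a b c d n * wordVal E Loop [(b, true)] ^ 2 ^ n =
      unwindElement E Loop a b c d n := by
  induction n with
  | zero => simp [roundElement, unwindElement]
  | succ n ih =>
    have h₁ : wordVal E Loop [(c, true), (b, true), (b, true)] =
      wordVal E Loop [(c, true)] * wordVal E Loop [(b, true)] ^ 2 := by rw [pow_two]; rfl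
    rw [roundElement_succ hab hbc ih, unwindElement, h₁,
      ((wordVal_commute hbc _ _).symm.pow_right 2).mul_pow, ← pow_mul, ← pow_succ',
      mul_assoc (_ * _) (_ ^ _), ((wordVal_commute hcd _ _).pow_left _).eq]
    simp only [mul_assoc]

theorem pathMachine_reach_round (a b c d : V) (n : ℕ) :
    Reach E Loop (pathMachine a b c d) 0 0 n 0 (roundElement E Loop a b c d n) := by
  induction n with
  | zero => exact ⟨_, .nil, rfl⟩
  | succ n ih =>
    convert ((ih.step (z := [(a, true)]) (i := 1) (j := 0) (q := 1) (by simp [pathMachine])).loop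
      (z := [(b, true), (c, true)]) (i := 0) (j := 0) (by simp [pathMachine]) (2 ^ n)).step
      (z := [(d, true)]) (i := 0) (j := 0) (q := 0) (by simp [pathMachine]) using 1
    · ring
    · ring
    · rw [roundElement]

theorem pathMachine_reach_unwind {a b c d : V} {n m : ℕ} (k : ℕ)
    (h : Reach E Loop (pathMachine a b c d) 0 3 n m (unwindElement E Loop a b c d k)) :
    Reach E Loop (pathMachine a b c d) 0 3 n m (wordVal E Loop [(b, true)]) := by
  induction k with
  | zero => exact h
  | succ k ih =>
    refine ih ?_
    convert (h.loop (z := [(b, false), (b, false), (c, false)]) (i := 0) (j := 0)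
      (by simp [pathMachine]) (2 ^ k)).step (z := [(d, false), (a, false)]) (i := 0) (j := 0) (q := 3)
      (by simp [pathMachine]) using 1
    · simp
    · simp
    · have h₁ : wordVal E Loop [(c, true), (b, true), (b, true)] *
          wordVal E Loop [(b, false), (b, false), (c, false)] = 1 := by
        have h₂ : wordVal E Loop [(c, true), (b, true), (b, true)] =
          wordVal E Loop [(c, true)] * wordVal E Loop [(b, true)] ^ 2 := by rw [pow_two]; rfl
        have h₃ : wordVal E Loop [(b, false), (b, false), (c, false)] =
          wordVal E Loop [(b, false)] ^ 2 * wordVal E Loop [(c, false)] := by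
            rw [pow_two, mul_assoc]; rfl
        rw [h₂, h₃, mul_assoc, ← mul_assoc (_ ^ 2), wordVal_pow_mul_pow_bar, one_mul,
          wordVal_mul_bar]
      have h₄ : wordVal E Loop [(d, false), (a, false)] =
        wordVal E Loop [(d, false)] * wordVal E Loop [(a, false)] := rfl
      rw [unwindElement, mul_assoc _ (_ ^ _) (_ ^ _), pow_mul_pow_eq_one _ h₁, mul_one, h₄, mul_assoc,
        ← mul_assoc (wordVal E Loop [(d, true)]), wordVal_mul_bar, one_mul, mul_assoc,
        wordVal_mul_bar, mul_one]

theorem exists_not_langSemilinear_of_path (hirr : ∀ v, ¬ E v v) (hsymm : ∀ v w, E v w → E w v)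
    {a b c d : V} (hab : E a b) (hbc : E b c) (hcd : E c d) (hac : ¬ E a c) (hbd : ¬ E b d)
    (hnac : a ≠ c) (hnbd : b ≠ d) (hnad : a ≠ d) :
    ∃ L : Language Bool, VA (MGraph V E Loop) L ∧ ¬ LangSemilinear L := by
  refine exists_not_langSemilinear_of_run (Δ := pathMachine a b c d) (s := 0) (r := 4) ?_ ?_
  · intro x n m hx h1
    have hne : ∀ {v w}, E v w → v ≠ w := by rintro v _ h rfl; exact hirr _ h
    have := ((pathMachine_invariant (hne hab) hnac hnad (hne hbc) hnbd (hne hcd) hx 1 0 1 0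
      (affineAct_foldl hirr hac (fun h => hac (hsymm _ _ h)) (y := []) h1 _)
      (affineAct_foldl hirr (fun h => hbd (hsymm _ _ h)) hbd (y := []) h1 _)).2.2.2.2 rfl).2
    have h2 : (m : ℚ) ≤ 2 ^ (n + 1) := by
      rw [one_div, inv_pow] at this
      field_simp at this
      rw [pow_succ]
      have : (0 : ℚ) ≤ m := m.cast_nonneg
      linarith
    exact_mod_cast h2
  · intro n
    have h := ((((pathMachine_reach_round (E := E) (Loop := Loop) a b c d (n + 1)).step
      (z := [(d, false)]) (i := 0) (j := 0) (q := 2) (by simp [pathMachine])).loop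
      (z := [(c, false)]) (i := 0) (j := 1) (by simp [pathMachine]) (2 ^ n)).step
      (z := [(a, false)]) (i := 0) (j := 0) (q := 3) (by simp [pathMachine]))
    simp only [mul_zero, mul_one, add_zero, zero_add] at h
    rw [roundElement_succ hab hbc (roundElement_mul_pow hab hbc hcd n),
      mul_assoc _ (wordVal E Loop [(d, true)]), wordVal_mul_bar, mul_one,
      mul_assoc _ (_ ^ _) (_ ^ _), wordVal_pow_mul_pow_bar, mul_one, mul_assoc, wordVal_mul_bar, mul_one] at h
    obtain ⟨x, hx, h1⟩ := (pathMachine_reach_unwind n h).step (z := [(b, false)]) (i := 0) (j := 0)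
      (q := 4) (by simp [pathMachine])
    exact ⟨x, _, by simpa using hx, h1.trans (wordVal_mul_bar b), le_rfl⟩

end Necessity

/-- All languages in `VA (M(Γ))` are semilinear iff (1) `Γ` has neither
two adjacent unlooped vertices nor an induced subgraph on `u, v, w` with `v` unlooped,
`u, w` looped, `v` adjacent to both and `u, w` non-adjacent, and (2) the underlying
loop-free graph of `Γ` has neither an induced `C₄` nor an induced `P₄`. -/
theorem stmt14 (V : Type) [Fintype V] (E : V → V → Prop) (Loop : V → Prop)
    (hsymm : Symmetric E) (hirr : Irreflexive E) :
    (∀ (X : Type) (_ : Fintype X) (L : Language X),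
        VA (MGraph V E Loop) L → LangSemilinear L) ↔
      (((¬ ∃ v w : V, v ≠ w ∧ E v w ∧ ¬ Loop v ∧ ¬ Loop w) ∧
        (¬ ∃ u v w : V, u ≠ v ∧ v ≠ w ∧ u ≠ w ∧
            ¬ Loop v ∧ Loop u ∧ Loop w ∧ E v u ∧ E v w ∧ ¬ E u w)) ∧
       ((¬ ∃ a b c d : V, a ≠ b ∧ a ≠ c ∧ a ≠ d ∧ b ≠ c ∧ b ≠ d ∧ c ≠ d ∧
            E a b ∧ E b c ∧ E c d ∧ E d a ∧ ¬ E a c ∧ ¬ E b d) ∧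
        (¬ ∃ a b c d : V, a ≠ b ∧ a ≠ c ∧ a ≠ d ∧ b ≠ c ∧ b ≠ d ∧ c ≠ d ∧
            E a b ∧ E b c ∧ E c d ∧ ¬ E a c ∧ ¬ E a d ∧ ¬ E b d))) := by
  have hs : ∀ v w, E v w → E w v := fun v w h => hsymm h
  have hi : ∀ v, ¬ E v v := fun v => hirr v
  constructor
  · intro h
    replace h : ¬ ∃ L : Language Bool, VA (MGraph V E Loop) L ∧ ¬ LangSemilinear L :=
      fun ⟨L, hL, hn⟩ => hn (h Bool inferInstance L hL)
    refine ⟨⟨?_, ?_⟩, ?_, ?_⟩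
    · rintro ⟨v, w, -, hvw, hv, hw⟩
      exact h (exists_not_langSemilinear_of_unlooped_edge hi hvw hv hw)
    · rintro ⟨u, v, w, -, -, huw, hv, -, -, hvu, hvw, hE⟩
      exact h (exists_not_langSemilinear_of_nonadjacent_neighbors hi hvu hvw hE
        (fun hE' => hE (hs _ _ hE')) huw hv)
    · rintro ⟨a, b, c, d, -, hac, had, -, hbd, -, hab, hbc, hcd, -, hEac, hEbd⟩
      exact h (exists_not_langSemilinear_of_path hi hs hab hbc hcd hEac hEbd hac hbd had)
    · rintro ⟨a, b, c, d, -, hac, had, -, hbd, -, hab, hbc, hcd, hEac, -, hEbd⟩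
      exact h (exists_not_langSemilinear_of_path hi hs hab hbc hcd hEac hEbd hac hbd had)
  · rintro ⟨⟨h₁, h₂⟩, h₃, h₄⟩ X _ L hL
    have hne : ∀ {v w}, E v w → v ≠ w := by rintro v _ h rfl; exact hi _ h
    refine langSemilinear_of_pathSemilinear (Finset.coe_univ (α := V) ▸
      pathSemilinear_of_forbidden hs hi ?_ ?_ ?_ Finset.univ) hL
    · intro v w hvw
      by_contra! hl
      exact h₁ ⟨v, w, hne hvw, hvw, hl⟩
    · intro u v w huw hv hu hw hvu hvw
      by_contra hE
      exact h₂ ⟨u, v, w, (hne hvu).symm, hne hvw, huw, hv, hu, hw, hvu, hvw, hE⟩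
    · intro a b c d hac hbd had hab hbc hcd
      by_contra! hE
      by_cases hda : E d a
      · exact h₃ ⟨a, b, c, d, hne hab, hac, had, hne hbc, hbd, hne hcd, hab, hbc, hcd, hda, hE⟩
      · exact h₄ ⟨a, b, c, d, hne hab, hac, had, hne hbc, hbd, hne hcd, hab, hbc, hcd, hE.1,
          fun h => hda (hs _ _ h), hE.2⟩

end Paper
end

section
/- Let G be a torsion group (every element has finite order), n ∈ ℕ, and let ℤⁿ denote the free abelian group of rank n written multiplicatively. Then the Dyck language D₁ over the alphabet {x, x̄} does not belong to VA(G × ℤⁿ). -/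
namespace Paper

/-- The one-sided Dyck language `D₁` over the alphabet `{x, x̄}`, encoded with
`x = true` and `x̄ = false`: words with equally many `x` and `x̄` in which every
prefix has at least as many `x` as `x̄`. -/
def Dyck : Language Bool :=
  {w | w.count true = w.count false ∧
    ∀ p : List Bool, p <+: w → p.count false ≤ p.count true}

/-- One piece of a factorised run: a word `base`, the state reached after reading it, and a
further word `loop` that may be inserted there. -/
structure Seg (Y σ : Type*) where
  base : FreeMonoid Y
  state : σ
  loop : FreeMonoid Y

namespace Seg

variable {Y σ N : Type*} [Monoid N]

/-- The word with all loops left out. -/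
def word (S : List (Seg Y σ)) : FreeMonoid Y := (S.map base).prod

/-- The word with all loops inserted. -/
def full (S : List (Seg Y σ)) : FreeMonoid Y := (S.map fun s => s.base * s.loop).prod

/-- The product of the values of all loops. -/
def loopVal (F : FreeMonoid Y →* N) (S : List (Seg Y σ)) : N := (S.map fun s => F s.loop).prod

@[simp] lemma word_nil : word ([] : List (Seg Y σ)) = 1 := rfl
@[simp] lemma full_nil : full ([] : List (Seg Y σ)) = 1 := rfl
@[simp] lemma loopVal_nil (F : FreeMonoid Y →* N) : loopVal F ([] : List (Seg Y σ)) = 1 := rfl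
@[simp] lemma word_cons (s : Seg Y σ) (S) : word (s :: S) = s.base * word S := by simp [word]
@[simp] lemma full_cons (s : Seg Y σ) (S) : full (s :: S) = s.base * s.loop * full S := by
  simp [full]
@[simp] lemma loopVal_cons (F : FreeMonoid Y →* N) (s : Seg Y σ) (S) :
    loopVal F (s :: S) = F s.loop * loopVal F S := by simp [loopVal]
@[simp] lemma word_append (S T : List (Seg Y σ)) : word (S ++ T) = word S * word T := by
  simp [word]
@[simp] lemma full_append (S T : List (Seg Y σ)) : full (S ++ T) = full S * full T := by
  simp [full]
@[simp] lemma loopVal_append (F : FreeMonoid Y →* N) (S T : List (Seg Y σ)) :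
    loopVal F (S ++ T) = loopVal F S * loopVal F T := by simp [loopVal]

lemma map_full_comm {A : Type*} [CommMonoid A] (F : FreeMonoid Y →* A) (S : List (Seg Y σ)) :
    F (full S) = F (word S) * loopVal F S := by
  induction S with
  | nil => simp
  | cons s S ih => simp only [full_cons, word_cons, loopVal_cons, map_mul, ih, mul_mul_mul_comm]

lemma map_full_of_loops_eq_one (F : FreeMonoid Y →* N) (S : List (Seg Y σ))
    (h : ∀ s ∈ S, F s.loop = 1) : F (full S) = F (word S) := by
  induction S with
  | nil => simp
  | cons s S ih => simp_all

/-- Raise every loop to the `k`-th power. -/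
def powLoops (k : ℕ) (S : List (Seg Y σ)) : List (Seg Y σ) :=
  S.map fun s => ⟨s.base, s.state, s.loop ^ k⟩

@[simp] lemma word_powLoops (k : ℕ) (S : List (Seg Y σ)) : word (powLoops k S) = word S := by
  induction S with
  | nil => rfl
  | cons s S ih => simpa [powLoops] using ih

@[simp] lemma loopVal_powLoops {A : Type*} [CommMonoid A] (F : FreeMonoid Y →* A) (k : ℕ)
    (S : List (Seg Y σ)) : loopVal F (powLoops k S) = loopVal F S ^ k := by
  induction S with
  | nil => simp [powLoops]
  | cons s S ih => simp_all [powLoops, mul_pow]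

end Seg

/-- The state reached from `q` by reading `w`. -/
def run {Y σ : Type*} (M : DFA Y σ) (q : σ) (w : FreeMonoid Y) : σ := M.evalFrom q w.toList

section Run

variable {Y σ : Type*} (M : DFA Y σ)

@[simp] lemma run_one (q : σ) : run M q 1 = q := rfl

@[simp] lemma run_mul (q : σ) (v w : FreeMonoid Y) :
    run M q (v * w) = run M (run M q v) w := M.evalFrom_of_append q v.toList w.toList

@[simp] lemma run_of (q : σ) (y : Y) : run M q (FreeMonoid.of y) = M.step q y := rfl

lemma run_pow {q : σ} {w : FreeMonoid Y} (h : run M q w = q) (k : ℕ) : run M q (w ^ k) = q := by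
  induction k with
  | zero => simp
  | succ k ih => rw [pow_succ, run_mul, ih, h]

/-- Starting in `p`, the run on the base words passes through the recorded states, and each
loop is a cycle at its state. -/
def Valid (M : DFA Y σ) : σ → List (Seg Y σ) → Prop
  | _, [] => True
  | p, s :: S => run M p s.base = s.state ∧ run M s.state s.loop = s.state ∧ Valid M s.state S

variable {M}

lemma Valid.append_iff {p : σ} {S T : List (Seg Y σ)} :
    Valid M p (S ++ T) ↔ Valid M p S ∧ Valid M (run M p (Seg.word S)) T := by
  induction S generalizing p with
  | nil => simp [Valid]
  | cons s S ih =>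
    simp only [List.cons_append, Valid, ih, Seg.word_cons, run_mul]
    constructor
    · rintro ⟨h, h', h'', h3⟩
      exact ⟨⟨h, h', h''⟩, h ▸ h3⟩
    · rintro ⟨⟨h, h', h''⟩, h3⟩
      exact ⟨h, h', h'', h ▸ h3⟩

lemma Valid.run_full {p : σ} {S : List (Seg Y σ)} (h : Valid M p S) :
    run M p (Seg.full S) = run M p (Seg.word S) := by
  induction S generalizing p with
  | nil => rfl
  | cons s S ih =>
    obtain ⟨h1, h2, h3⟩ := h
    simp [h1, h2, ih h3]

lemma Valid.powLoops {p : σ} {S : List (Seg Y σ)} (h : Valid M p S) (k : ℕ) :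
    Valid M p (Seg.powLoops k S) := by
  induction S generalizing p with
  | nil => trivial
  | cons s S ih => exact ⟨h.1, run_pow M h.2.1 k, ih h.2.2⟩

end Run

lemma exists_common_exponent {G : Type*} [Group G] (hG : ∀ g : G, ∃ n : ℕ, 0 < n ∧ g ^ n = 1)
    (l : List G) : ∃ n : ℕ, 0 < n ∧ ∀ g ∈ l, g ^ n = 1 := by
  induction l with
  | nil => exact ⟨1, one_pos, by simp⟩
  | cons g l ih =>
    obtain ⟨n, hn, h⟩ := ih
    obtain ⟨m, hm, hg⟩ := hG g
    refine ⟨m * n, Nat.mul_pos hm hn, ?_⟩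
    simp only [List.mem_cons, forall_eq_or_imp]
    exact ⟨by rw [pow_mul, hg, one_pow], fun x hx => by rw [mul_comm, pow_mul, h x hx, one_pow]⟩

open Seg in
/-- If the loops have trivial total commutative value, then moving a descending loop to an
earlier occurrence of its state and pumping yields an accepted word with a prefix of negative
height. -/
lemma exists_pumped {Y σ G A : Type*} [Group G] [CommMonoid A]
    (hG : ∀ g : G, ∃ n : ℕ, 0 < n ∧ g ^ n = 1) {M : DFA Y σ}
    (φ : FreeMonoid Y →* G) (ζ : FreeMonoid Y →* A) (d : FreeMonoid Y →* Multiplicative ℤ)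
    {p : σ} {S T : List (Seg Y σ)} (hv : Valid M p (S ++ T))
    (hφ : φ (word (S ++ T)) = 1) (hζ : ζ (word (S ++ T)) = 1) (hl : loopVal ζ (S ++ T) = 1)
    (hd : loopVal d S = 1) {s t : Seg Y σ} (hs : s ∈ S) (ht : t ∈ T) (hst : s.state = t.state)
    (hneg : (d t.loop).toAdd < 0) :
    ∃ v w : FreeMonoid Y, run M p (v * w) = run M p (word (S ++ T)) ∧ φ (v * w) = 1 ∧
      ζ (v * w) = 1 ∧ (d v).toAdd < 0 := by
  obtain ⟨k₀, hk₀, hk⟩ := exists_common_exponent hG ((S ++ T).map fun s => φ s.loop)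
  obtain ⟨k, hk1, hk2⟩ : ∃ k : ℕ, (∀ s ∈ S ++ T, φ s.loop ^ k = 1) ∧
      (d (word S)).toAdd < k := by
    refine ⟨k₀ * ((d (word S)).toAdd.toNat + 1), fun s hs => ?_, ?_⟩
    · rw [pow_mul, hk _ (List.mem_map_of_mem hs), one_pow]
    · have := Int.self_le_toNat (d (word S)).toAdd
      push_cast
      nlinarith [(by exact_mod_cast hk₀ : (1 : ℤ) ≤ k₀)]
  obtain ⟨S₁, S₂, rfl⟩ := List.append_of_mem hs
  obtain ⟨T₁, T₂, rfl⟩ := List.append_of_mem ht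
  set S' := powLoops k S₁ ++ ⟨s.base, s.state, s.loop ^ k * t.loop ^ k⟩ :: powLoops k S₂
  set T' := powLoops k T₁ ++ ⟨t.base, t.state, 1⟩ :: powLoops k T₂
  have hw : word (S' ++ T') = word (S₁ ++ s :: S₂ ++ (T₁ ++ t :: T₂)) := by simp [S', T']
  have hv' : Valid M p (S' ++ T') := by
    simp only [Valid.append_iff, Valid] at hv
    obtain ⟨⟨h1, h2, h3, h4⟩, h5, h6, h7, h8⟩ := hv
    simp only [S', T', Valid.append_iff, Valid, word_powLoops, word_append, word_cons, run_mul,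
      run_pow M h3, run_one, true_and]
    simp only [word_append, word_cons, run_mul] at h5 h6
    exact ⟨⟨h1.powLoops k, h2, by rw [hst] at *; exact run_pow M h7 k, h4.powLoops k⟩,
      h5.powLoops k, h6, h8.powLoops k⟩
  refine ⟨full S', full T', ?_, ?_, ?_, ?_⟩
  · rw [← full_append, hv'.run_full, hw]
  · rw [← full_append, map_full_of_loops_eq_one, hw, hφ]
    intro x hx
    simp only [S', T', powLoops, List.mem_append, List.mem_map, List.mem_cons] at hx
    rcases hx with (⟨y, hy, rfl⟩ | rfl | ⟨y, hy, rfl⟩) | ⟨y, hy, rfl⟩ | rfl | ⟨y, hy, rfl⟩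
    · simpa using hk1 y (by simp [hy])
    · simp [hk1 s (by simp), hk1 t (by simp)]
    · simpa using hk1 y (by simp [hy])
    · simpa using hk1 y (by simp [hy])
    · simp
    · simpa using hk1 y (by simp [hy])
  · rw [← full_append, map_full_comm, hw, hζ, one_mul]
    calc loopVal ζ (S' ++ T') = loopVal ζ (S₁ ++ s :: S₂ ++ (T₁ ++ t :: T₂)) ^ k := by
          simp only [S', T', loopVal_append, loopVal_cons, loopVal_powLoops, map_mul, map_pow,
            map_one, mul_pow, one_mul]
          ac_rfl
      _ = 1 := by rw [hl, one_pow]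
  · have h1 : loopVal d S' = d t.loop ^ k := by
      calc loopVal d S' = loopVal d (S₁ ++ s :: S₂) ^ k * d t.loop ^ k := by
            simp only [S', loopVal_append, loopVal_cons, loopVal_powLoops, map_mul, map_pow,
              mul_pow, mul_assoc, mul_comm]
        _ = d t.loop ^ k := by rw [hd, one_pow, one_mul]
    have h2 : word S' = word (S₁ ++ s :: S₂) := by simp [S']
    rw [map_full_comm, h1, h2, toAdd_mul, toAdd_pow, nsmul_eq_mul]
    nlinarith

/-- The letters of `w`, each labelled with the state in which it is read. -/
def labelled {Y σ : Type*} (M : DFA Y σ) : σ → List Y → List (σ × Y)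
  | _, [] => []
  | q, y :: w => (q, y) :: labelled M (M.step q y) w

open Seg in
lemma exists_segs_aux {Y σ : Type*} {M : DFA Y σ} {v w : List Y} {q p : σ}
    (h : (labelled M q v).Sublist (labelled M p w)) (he : M.evalFrom q v = M.evalFrom p w) :
    ∃ (u : FreeMonoid Y) (S : List (Seg Y σ)), run M p u = q ∧ Valid M q S ∧
      word S = FreeMonoid.ofList v ∧ u * full S = FreeMonoid.ofList w := by
  induction w generalizing v q p with
  | nil =>
    cases v with
    | nil => exact ⟨1, [], he.symm, trivial, rfl, rfl⟩
    | cons y v => simp [labelled] at h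
  | cons z w ih =>
    cases h' : labelled M q v with
    | nil =>
      cases v with
      | nil => exact ⟨FreeMonoid.ofList (z :: w), [], he.symm, trivial, rfl, by simp⟩
      | cons y v => simp [labelled] at h'
    | cons x l =>
      rw [h', labelled] at h
      by_cases hx : x = (p, z) ∧ l.Sublist (labelled M (M.step p z) w)
      · obtain ⟨rfl, hl⟩ := hx
        cases v with
        | nil => simp [labelled] at h'
        | cons y v =>
          simp only [labelled, List.cons.injEq, Prod.mk.injEq] at h'
          obtain ⟨⟨rfl, rfl⟩, rfl⟩ := h'
          obtain ⟨u, S, h1, h2, h3, h4⟩ := ih hl he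
          refine ⟨1, ⟨FreeMonoid.of y, M.step q y, u⟩ :: S, rfl, ⟨rfl, h1, h2⟩, ?_, ?_⟩
          · simp [h3, FreeMonoid.ofList_cons]
          · simp [mul_assoc, h4, FreeMonoid.ofList_cons]
      · have h2 : (labelled M q v).Sublist (labelled M (M.step p z) w) := by
          rw [h']
          cases h with
          | cons _ h => exact h
          | cons_cons _ h => exact absurd ⟨rfl, h⟩ hx
        obtain ⟨u, S, h1, h2, h3, h4⟩ := ih h2 he
        refine ⟨FreeMonoid.of z * u, S, by simpa using h1, h2, h3, ?_⟩
        rw [mul_assoc, h4, FreeMonoid.ofList_cons]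

open Seg in
/-- If the run on `v` embeds into the run on `w`, then `w` arises from `v` by inserting cycles. -/
lemma exists_segs {Y σ : Type*} {M : DFA Y σ} {v w : FreeMonoid Y} {q : σ}
    (h : (labelled M q v.toList).Sublist (labelled M q w.toList)) (he : run M q v = run M q w) :
    ∃ S : List (Seg Y σ), Valid M q S ∧ word S = v ∧ full S = w := by
  obtain ⟨u, S, h1, h2, h3, h4⟩ := exists_segs_aux h he
  exact ⟨⟨1, q, u⟩ :: S, ⟨rfl, h1, h2⟩, by simpa using h3, by simpa using h4⟩

section Blocks

variable {Y σ : Type*} (M : DFA Y σ) (d : FreeMonoid Y →* Multiplicative ℤ) (D : ℕ)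

/-- The word spelled by a list of blocks, each given by an ascending and a descending part. -/
def blockWord (bs : List (FreeMonoid Y × FreeMonoid Y)) : FreeMonoid Y :=
  (bs.map fun b => b.1 * b.2).prod

@[simp] lemma blockWord_cons (b : FreeMonoid Y × FreeMonoid Y) (bs) :
    blockWord (b :: bs) = b.1 * b.2 * blockWord bs := by simp [blockWord]

/-- The data of a block that are compared by the well-quasi-order. -/
abbrev BlockKey (Y σ : Type*) (D : ℕ) : Type _ :=
  (σ × σ × ZMod D) × List (σ × Y) × List (σ × Y)

/-- The comparison of block data: equality of the finite part, embedding of the runs. -/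
def BlockKey.Le (a b : BlockKey Y σ D) : Prop :=
  a.1 = b.1 ∧ a.2.1.Sublist b.2.1 ∧ a.2.2.Sublist b.2.2

/-- The data of the blocks of a word read from state `q`. -/
def blockKeys : σ → List (FreeMonoid Y × FreeMonoid Y) → List (BlockKey Y σ D)
  | _, [] => []
  | q, b :: bs =>
    ((run M q b.1, run M q (b.1 * b.2), ((d (b.1 * b.2)).toAdd : ZMod D)),
      labelled M q b.1.toList, labelled M (run M q b.1) b.2.toList) ::
      blockKeys (run M q (b.1 * b.2)) bs

variable {M d D}

lemma length_blockKeys (q : σ) (bs) : (blockKeys M d D q bs).length = bs.length := by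
  induction bs generalizing q with
  | nil => rfl
  | cons b bs ih => simp [blockKeys, ih]

instance : IsPreorder (BlockKey Y σ D) (BlockKey.Le D) where
  refl _ := ⟨rfl, .refl _, .refl _⟩
  trans _ _ _ h h' := ⟨h.1.trans h'.1, h.2.1.trans h'.2.1, h.2.2.trans h'.2.2⟩

lemma wellQuasiOrdered_eq (α : Type*) [Finite α] : WellQuasiOrdered (Eq : α → α → Prop) :=
  Finite.wellQuasiOrdered _

lemma wellQuasiOrdered_sublistForall₂ {α : Type*} {r : α → α → Prop} [IsPreorder α r]
    (h : WellQuasiOrdered r) : WellQuasiOrdered (List.SublistForall₂ r) := by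
  rw [← Set.partiallyWellOrderedOn_univ_iff] at h ⊢
  simpa using Set.PartiallyWellOrderedOn.partiallyWellOrderedOn_sublistForall₂ r h

lemma wellQuasiOrdered_sublist (α : Type*) [Finite α] :
    WellQuasiOrdered (List.Sublist : List α → List α → Prop) := by
  have h := wellQuasiOrdered_sublistForall₂ (wellQuasiOrdered_eq α)
  have : List.SublistForall₂ (Eq : α → α → Prop) = List.Sublist := by
    ext l l'
    simp [List.sublistForall₂_iff]
  rwa [this] at h

lemma BlockKey.wellQuasiOrdered [Finite Y] [Finite σ] [NeZero D] :
    WellQuasiOrdered (BlockKey.Le (Y := Y) (σ := σ) D) :=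
  have : IsPreorder (List (σ × Y)) List.Sublist := { refl := .refl, trans := fun _ _ _ => .trans }
  (wellQuasiOrdered_eq _).prod ((wellQuasiOrdered_sublist _).prod (wellQuasiOrdered_sublist _))

open Seg in
/-- From two block words with comparable data, obtain a factorisation of the larger one into the
smaller one and inserted cycles, blockwise. -/
lemma exists_block_segs {C : ℤ} (hD : 2 * C < D) {q : σ}
    {bs bs' : List (FreeMonoid Y × FreeMonoid Y)}
    (h : List.Forall₂ (BlockKey.Le D) (blockKeys M d D q bs) (blockKeys M d D q bs'))
    (hC : ∀ b ∈ bs, |(d (b.1 * b.2)).toAdd| ≤ C) (hC' : ∀ b ∈ bs', |(d (b.1 * b.2)).toAdd| ≤ C)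
    (hlt : ∀ b ∈ bs, ∀ b' ∈ bs', (d b.1).toAdd < (d b'.1).toAdd) :
    ∃ T : List (List (Seg Y σ)), T.length = bs.length ∧ Valid M q T.flatten ∧
      word T.flatten = blockWord bs ∧ full T.flatten = blockWord bs' ∧
      ∀ S ∈ T, loopVal d S = 1 ∧ ∃ s ∈ S, (d s.loop).toAdd < 0 := by
  induction bs generalizing bs' q with
  | nil =>
    cases bs' with
    | nil => exact ⟨[], rfl, trivial, rfl, rfl, by simp⟩
    | cons b bs => simp [blockKeys] at h
  | cons b bs ih =>
    cases bs' with
    | nil => simp [blockKeys] at h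
    | cons b' bs' =>
      simp only [blockKeys, List.forall₂_cons] at h
      obtain ⟨⟨heq, h1, h2⟩, h3⟩ := h
      simp only [Prod.mk.injEq] at heq
      obtain ⟨e1, e2, e3⟩ := heq
      simp only [List.mem_cons, forall_eq_or_imp] at hC hC' hlt
      simp only at h1 h2
      rw [← e1] at h2
      rw [← e2] at h3
      have e2' : run M (run M q b.1) b.2 = run M (run M q b.1) b'.2 := by
        simpa [← e1] using e2
      obtain ⟨P, hP1, hP2, hP3⟩ := exists_segs h1 e1
      obtain ⟨Q, hQ1, hQ2, hQ3⟩ := exists_segs h2 e2'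
      obtain ⟨T, hT1, hT2, hT3, hT4, hT5⟩ := ih h3 hC.2 hC'.2 fun x hx y hy =>
        (hlt.2 x hx).2 y hy
      have e3' : (d (b.1 * b.2)).toAdd = (d (b'.1 * b'.2)).toAdd := by
        rw [ZMod.intCast_eq_intCast_iff_dvd_sub] at e3
        have := Int.eq_zero_of_abs_lt_dvd e3
          (by have := abs_sub (d (b'.1 * b'.2)).toAdd (d (b.1 * b.2)).toAdd
              linarith [hC.1, hC'.1])
        linarith
      have dP := congrArg Multiplicative.toAdd (map_full_comm d P)
      have dQ := congrArg Multiplicative.toAdd (map_full_comm d Q)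
      have hl := hlt.1.1
      rw [hP2, hP3, toAdd_mul] at dP
      rw [hQ2, hQ3, toAdd_mul] at dQ
      simp only [map_mul, toAdd_mul] at e3'
      refine ⟨(P ++ Q) :: T, by simp [hT1], ?_, ?_, ?_, ?_⟩
      · simp only [List.flatten_cons, Valid.append_iff, word_append, hP2, hQ2]
        exact ⟨⟨hP1, hQ1⟩, hT2⟩
      · simp [hP2, hQ2, hT3, mul_assoc]
      · simp [hP3, hQ3, hT4, mul_assoc]
      · simp only [List.mem_cons, forall_eq_or_imp]
        refine ⟨⟨?_, ?_⟩, hT5⟩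
        · apply Multiplicative.toAdd.injective
          rw [loopVal_append, toAdd_mul, toAdd_one]
          linarith
        · by_contra! hc
          have : 0 ≤ (loopVal d Q).toAdd := by
            have hn : ∀ l : List (Seg Y σ), (∀ s ∈ l, 0 ≤ (d s.loop).toAdd) →
                0 ≤ (loopVal d l).toAdd := by
              intro l hl
              induction l with
              | nil => simp
              | cons s l ih =>
                simp only [List.mem_cons, forall_eq_or_imp] at hl
                rw [loopVal_cons, toAdd_mul]
                exact add_nonneg hl.1 (ih hl.2)
            exact hn Q fun s hs => hc s (by simp [hs])
          linarith

end Blocks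

/-- The height of a word over `{x, x̄}`: the number of `x` minus the number of `x̄`. -/
def height : FreeMonoid Bool →* Multiplicative ℤ :=
  FreeMonoid.lift fun b => Multiplicative.ofAdd (if b then 1 else -1)

lemma toAdd_height (w : FreeMonoid Bool) :
    (height w).toAdd = (w.toList.count true : ℤ) - w.toList.count false := by
  induction w using FreeMonoid.inductionOn' with
  | one => simp
  | of_mul b w ih =>
    rw [map_mul, toAdd_mul, ih]
    cases b <;> simp [height] <;> ring

lemma abs_height_le (w : FreeMonoid Bool) : |(height w).toAdd| ≤ w.length := by
  rw [toAdd_height, abs_le]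
  have h := List.count_le_length (a := true) (l := w.toList)
  have h' := List.count_le_length (a := false) (l := w.toList)
  simp only [FreeMonoid.length]
  omega

/-- The word `xᵐ x̄ᵐ`. -/
def peak (m : ℕ) : FreeMonoid Bool := FreeMonoid.of true ^ m * FreeMonoid.of false ^ m

lemma toList_of_pow {α : Type*} (a : α) (m : ℕ) :
    (FreeMonoid.of a ^ m).toList = List.replicate m a := by
  induction m with
  | zero => rfl
  | succ m ih => rw [pow_succ', FreeMonoid.toList_of_mul, ih, List.replicate_succ]

lemma append_mem_Dyck {v w : List Bool} (hv : v ∈ Dyck) (hw : w ∈ Dyck) : v ++ w ∈ Dyck := by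
  refine ⟨by rw [List.count_append, List.count_append, hv.1, hw.1], fun p hp => ?_⟩
  rcases List.prefix_or_prefix_of_prefix hp (List.prefix_append v w) with h | ⟨r, rfl⟩
  · exact hv.2 p h
  · rw [List.count_append, List.count_append, hv.1]
    exact Nat.add_le_add_left (hw.2 r ((List.prefix_append_right_inj v).mp hp)) _

lemma peak_mem_Dyck (m : ℕ) : (peak m).toList ∈ Dyck := by
  rw [peak, FreeMonoid.toList_mul, toList_of_pow, toList_of_pow]
  refine ⟨by simp [List.count_replicate], fun p hp => ?_⟩
  rw [List.prefix_iff_eq_take.mp hp]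
  simp [List.take_append, List.take_replicate, List.count_replicate]

lemma peak_pow_mem_Dyck (m N : ℕ) : (peak m ^ N).toList ∈ Dyck := by
  induction N with
  | zero => exact ⟨rfl, fun p hp => by simp_all⟩
  | succ N ih => rw [pow_succ, FreeMonoid.toList_mul]; exact append_mem_Dyck ih (peak_mem_Dyck m)

section Cut

variable {Y X : Type*} {h : FreeMonoid Y →* FreeMonoid X} {C : ℕ}

/-- A factorisation of `h w` lifts to `w`, up to an overlap of bounded length. -/
lemma exists_cut (hC : ∀ y, (h (FreeMonoid.of y)).length ≤ C) (w : FreeMonoid Y)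
    (s t : FreeMonoid X) (hw : h w = s * t) :
    ∃ w₁ w₂ s', w = w₁ * w₂ ∧ h w₁ * s' = s ∧ h w₂ = s' * t ∧ s'.length ≤ C := by
  induction w using FreeMonoid.inductionOn' generalizing s with
  | one =>
    have := congrArg FreeMonoid.length hw
    simp only [map_one, FreeMonoid.length_one, FreeMonoid.length_mul] at this
    refine ⟨1, 1, s, by simp, by simp, by simpa using hw, by omega⟩
  | of_mul y w ih =>
    rw [map_mul] at hw
    rcases List.append_eq_append_iff.mp hw with ⟨r, hr, hr'⟩ | ⟨r, hr, hr'⟩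
    · obtain ⟨w₁, w₂, s', rfl, h1, h2, h3⟩ := ih r hr'
      refine ⟨FreeMonoid.of y * w₁, w₂, s', by rw [mul_assoc], ?_, h2, h3⟩
      rw [map_mul, mul_assoc, h1]
      exact hr.symm
    · refine ⟨1, FreeMonoid.of y * w, s, by simp, by simp, by rw [map_mul, hw], ?_⟩
      refine le_trans ?_ (hC y)
      have := congrArg List.length hr
      rw [List.length_append] at this
      exact le_of_le_of_eq (Nat.le_add_right _ _) this.symm

end Cut

/-- A preimage of a power of `xᵐ x̄ᵐ` splits into blocks, each of which ascends by about `m` and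
then returns to about its initial height. -/
lemma exists_blocks {Y : Type*} {h : FreeMonoid Y →* FreeMonoid Bool} {C : ℕ}
    (hC : ∀ y, (h (FreeMonoid.of y)).length ≤ C) (m N : ℕ) (w : FreeMonoid Y)
    (s : FreeMonoid Bool) (hs : s.length ≤ C) (hw : h w = s * peak m ^ (N + 1)) :
    ∃ bs : List (FreeMonoid Y × FreeMonoid Y), bs.length = N + 1 ∧ blockWord bs = w ∧
      ∀ b ∈ bs, |(height (h (b.1 * b.2))).toAdd| ≤ 2 * C ∧
        |(height (h b.1)).toAdd - m| ≤ 2 * C := by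
  have key : ∀ (s t : FreeMonoid Bool) (w : FreeMonoid Y), s.length ≤ C → h w = s * (peak m * t) →
      ∃ p w' s', w = p * w' ∧ h w' = s' * (FreeMonoid.of false ^ m * t) ∧ s'.length ≤ C ∧
        (height (h p)).toAdd = (height s).toAdd + m - (height s').toAdd := by
    intro s t w hs hw
    obtain ⟨p, w', s', h1, h2, h3, h4⟩ := exists_cut hC w (s * FreeMonoid.of true ^ m)
      (FreeMonoid.of false ^ m * t) (by rw [hw, peak]; simp only [mul_assoc])
    refine ⟨p, w', s', h1, h3, h4, ?_⟩
    have := congrArg (fun v => (height v).toAdd) h2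
    simp [height] at this ⊢
    linarith
  have hneg : ((height (FreeMonoid.of false ^ m)).toAdd : ℤ) = -m := by simp [height]
  have hab := abs_height_le s
  have hs' : ((s.length : ℕ) : ℤ) ≤ C := by exact_mod_cast hs
  induction N generalizing w s with
  | zero =>
    obtain ⟨p, r, s', rfl, h2, h3, h4⟩ := key s 1 w hs (by simpa using hw)
    refine ⟨[(p, r)], rfl, by simp [blockWord], ?_⟩
    have hab' := abs_height_le s'
    have h3' : ((s'.length : ℕ) : ℤ) ≤ C := by exact_mod_cast h3
    simp only [List.mem_singleton, forall_eq]
    rw [map_mul, map_mul, toAdd_mul, h4, h2, mul_one, map_mul, toAdd_mul, hneg]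
    rw [abs_le] at *
    rw [abs_le]
    omega
  | succ N ih =>
    obtain ⟨p, w', s', rfl, h2, h3, h4⟩ := key s (peak m ^ (N + 1)) w hs
      (by rw [hw, pow_succ' _ (N + 1)])
    obtain ⟨r, w'', s'', rfl, h6, h7, h8⟩ := exists_cut hC w' (s' * FreeMonoid.of false ^ m)
      (peak m ^ (N + 1)) (by rw [h2]; simp only [mul_assoc])
    have hab' := abs_height_le s'
    have hab'' := abs_height_le s''
    have h3' : ((s'.length : ℕ) : ℤ) ≤ C := by exact_mod_cast h3
    have h8' : ((s''.length : ℕ) : ℤ) ≤ C := by exact_mod_cast h8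
    obtain ⟨bs, hb1, hb2, hb3⟩ := ih w'' s'' h8 h7 hab'' h8'
    refine ⟨(p, r) :: bs, by simp [hb1], by simp [hb2, mul_assoc], ?_⟩
    simp only [List.mem_cons, forall_eq_or_imp]
    refine ⟨?_, hb3⟩
    have h9 := congrArg (fun v => (height v).toAdd) h6
    simp only [map_mul, toAdd_mul, hneg] at h9
    rw [map_mul, map_mul, toAdd_mul, h4]
    rw [abs_le] at *
    rw [abs_le]
    omega

/-- A list longer than the cardinality of `σ` has two entries, at different positions, with the
same value under `f : α → σ`. -/
lemma exists_split_of_card_lt {α σ : Type*} [Fintype σ] (f : α → σ) (l : List α)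
    (hl : Fintype.card σ < l.length) :
    ∃ (l₁ : List α) (a : α) (l₂ : List α) (b : α) (l₃ : List α),
      l = l₁ ++ a :: l₂ ++ b :: l₃ ∧ f a = f b := by
  have hn : ¬ (l.map f).Nodup := fun h => by
    have := h.length_le_card
    rw [List.length_map] at this
    omega
  rw [List.nodup_iff_sublist] at hn
  push Not at hn
  obtain ⟨x, hx⟩ := hn
  obtain ⟨l', h1, h2⟩ := List.sublist_map_iff.mp hx
  obtain ⟨a, b, rfl⟩ := List.length_eq_two.mp
    (by simpa using (congrArg List.length h2).symm : l'.length = 2)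
  simp only [List.map_cons, List.map_nil, List.cons.injEq, and_true] at h2
  obtain ⟨r, r', rfl, hr, h3⟩ := List.cons_sublist_iff.mp h1
  obtain ⟨l₁, l₂, rfl⟩ := List.append_of_mem hr
  obtain ⟨l₃, l₄, rfl⟩ := List.append_of_mem (List.singleton_sublist.mp h3)
  exact ⟨l₁, a, l₂ ++ l₃, b, l₄, by simp, h2.1.symm.trans h2.2⟩

open Seg in
/-- For every torsion group `G` and `n ∈ ℕ`, the Dyck language `D₁`
is not in `VA (G × ℤⁿ)` (with `ℤⁿ` written multiplicatively). -/
theorem stmt19 (G : Type*) [Group G] (hG : ∀ g : G, ∃ n : ℕ, 0 < n ∧ g ^ n = 1)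
    (n : ℕ) :
    ¬ VA (G × Multiplicative (Fin n → ℤ)) Dyck := by
  rintro ⟨Y, _, R, φ, h, ⟨σ, _, M, rfl⟩, hL⟩
  obtain ⟨C, hC⟩ : ∃ C : ℕ, ∀ y, (h (FreeMonoid.of y)).length ≤ C :=
    ⟨∑ y, (h (FreeMonoid.of y)).length, fun y =>
      Finset.single_le_sum (f := fun y => (h (FreeMonoid.of y)).length)
        (fun _ _ => Nat.zero_le _) (Finset.mem_univ y)⟩
  set d := height.comp h
  set D := 4 * C + 1 with hD
  have hbs : ∀ i : ℕ, ∃ bs : List (FreeMonoid Y × FreeMonoid Y),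
      bs.length = Fintype.card σ + 1 ∧ run M M.start (blockWord bs) ∈ M.accept ∧
      φ (blockWord bs) = 1 ∧ ∀ b ∈ bs, |(d (b.1 * b.2)).toAdd| ≤ 2 * C ∧
        |(d b.1).toAdd - (D * i : ℕ)| ≤ 2 * C := by
    intro i
    have hi := peak_pow_mem_Dyck (D * i) (Fintype.card σ + 1)
    rw [hL] at hi
    obtain ⟨w, ⟨hw1, hw2⟩, hw3⟩ := hi
    obtain ⟨bs, h1, rfl, h3⟩ := exists_blocks hC (D * i) (Fintype.card σ) w 1 (by simp)
      (by rw [one_mul]; exact hw3)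
    exact ⟨bs, h1, hw1, hw2, h3⟩
  choose bs hlen hacc hone hbd using hbs
  have : NeZero D := ⟨by omega⟩
  obtain ⟨i, j, hij, hle⟩ :=
    wellQuasiOrdered_sublistForall₂ (BlockKey.wellQuasiOrdered (Y := Y) (σ := σ) (D := D))
      fun i => blockKeys M d D M.start (bs i)
  have hfor : List.Forall₂ (BlockKey.Le D) (blockKeys M d D M.start (bs i))
      (blockKeys M d D M.start (bs j)) := by
    obtain ⟨l, h1, h2⟩ := List.sublistForall₂_iff.mp hle
    rwa [h2.eq_of_length (by rw [← h1.length_eq]; simp [length_blockKeys, hlen])] at h1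
  obtain ⟨T, hT1, hT2, hT3, hT4, hT5⟩ := exists_block_segs (C := 2 * C) (by omega) hfor
    (fun b hb => (hbd i b hb).1) (fun b hb => (hbd j b hb).1) (by
      intro b hb b' hb'
      have h1 := (hbd i b hb).2
      have h2 := (hbd j b' hb').2
      have h3 : D * i + D ≤ D * j := by nlinarith
      rw [abs_le] at h1 h2
      omega)
  have hT6 : ∀ S : List (Seg Y σ), ∃ q : σ, S ∈ T →
      ∃ s ∈ S, (d s.loop).toAdd < 0 ∧ s.state = q := by
    intro S
    by_cases hS : S ∈ T
    · obtain ⟨s, hs, hs'⟩ := (hT5 S hS).2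
      exact ⟨s.state, fun _ => ⟨s, hs, hs', rfl⟩⟩
    · exact ⟨M.start, fun h => absurd h hS⟩
  choose f hf using hT6
  obtain ⟨T₁, a, T₂, b, T₃, rfl, hab⟩ := exists_split_of_card_lt f T (by rw [hT1, hlen]; omega)
  obtain ⟨s, hs, -, hs'⟩ := hf a (by simp)
  obtain ⟨t, ht, hneg, ht'⟩ := hf b (by simp)
  set A := T₁ ++ a :: T₂
  rw [List.flatten_append] at hT2 hT3 hT4
  have hdA : loopVal d A.flatten = 1 := by
    have : ∀ B : List (List (Seg Y σ)), (∀ S ∈ B, loopVal d S = 1) →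
        loopVal d B.flatten = 1 := by
      intro B hB
      induction B with
      | nil => rfl
      | cons S B ih => simp_all
    exact this A fun S hS => (hT5 S (List.mem_append_left _ hS)).1
  have hζ := map_full_comm ((MonoidHom.snd _ _).comp φ) (A.flatten ++ (b :: T₃).flatten)
  simp only [hT3, hT4, MonoidHom.comp_apply, hone, map_one, one_mul] at hζ
  obtain ⟨v, w, h1, h2, h3, h4⟩ := exists_pumped hG ((MonoidHom.fst _ _).comp φ)
    ((MonoidHom.snd _ _).comp φ) d hT2 (by rw [hT3, MonoidHom.comp_apply, hone, map_one])
    (by rw [hT3, MonoidHom.comp_apply, hone, map_one]) hζ.symm hdA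
    (s := s) (t := t) (by simp [A, hs]) (by simp [ht]) (by rw [hs', ht', hab]) hneg
  have hmem : FreeMonoid.toList (h (v * w)) ∈ Dyck := by
    rw [hL]
    refine ⟨v * w, ⟨?_, Prod.ext h2 h3⟩, rfl⟩
    change run M M.start (v * w) ∈ M.accept
    rw [h1, hT3]
    exact hacc i
  have hp := hmem.2 (h v).toList (by rw [map_mul]; exact List.prefix_append _ _)
  simp only [d, MonoidHom.comp_apply, toAdd_height] at h4
  omega

end Paper
end
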